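/- arXiv:2508.09047 — 8 statements merged into one kernel-verified Lean document; each statement's English description precedes it below -/
import Mathlib

section
/- Let n ≥ 2 and let Φ ∈ H. For every x ∈ ℝⁿ the Dirac operator applied to the spinor bubbles satisfies D ψ⁻_Φ(x) = (n/(1+‖x‖²)) · ψ⁻_Φ(x) and D ψ⁺_Φ(x) = −(n/(1+‖x‖²)) · ψ⁺_Φ(x). -/
open scoped RealInnerProductSpace
open MeasureTheory

noncomputable section

/-- The Dirac operator on spinor fields `ψ : ℝⁿ → H`, relative to Clifford
multiplication `γ` and the standard orthonormal basis of `ℝⁿ`. -/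
def Dirac {n : ℕ} {H : Type*} [NormedAddCommGroup H] [InnerProductSpace ℝ H]
    (γ : EuclideanSpace ℝ (Fin n) →ₗ[ℝ] H →ₗ[ℝ] H)
    (ψ : EuclideanSpace ℝ (Fin n) → H) (x : EuclideanSpace ℝ (Fin n)) : H :=
  ∑ i : Fin n, γ (EuclideanSpace.single i (1 : ℝ))
    (fderiv ℝ ψ x (EuclideanSpace.single i (1 : ℝ)))

/-- The spinor bubble `ψ⁻_Φ(x) = (2/(1+‖x‖²))^{n/2} (Φ − γ(x)Φ)`. -/
def psiNeg {n : ℕ} {H : Type*} [NormedAddCommGroup H] [InnerProductSpace ℝ H]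
    (γ : EuclideanSpace ℝ (Fin n) →ₗ[ℝ] H →ₗ[ℝ] H)
    (Φ : H) (x : EuclideanSpace ℝ (Fin n)) : H :=
  (((2 / (1 + ‖x‖ ^ 2) : ℝ)) ^ ((n : ℝ) / 2)) • (Φ - γ x Φ)

/-- The spinor bubble `ψ⁺_Φ(x) = (2/(1+‖x‖²))^{n/2} (Φ + γ(x)Φ)`. -/
def psiPos {n : ℕ} {H : Type*} [NormedAddCommGroup H] [InnerProductSpace ℝ H]
    (γ : EuclideanSpace ℝ (Fin n) →ₗ[ℝ] H →ₗ[ℝ] H)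
    (Φ : H) (x : EuclideanSpace ℝ (Fin n)) : H :=
  (((2 / (1 + ‖x‖ ^ 2) : ℝ)) ^ ((n : ℝ) / 2)) • (Φ + γ x Φ)

/-- The gradient of the conformal factor `(2/(1+‖x‖²))^p` is `-(2p/(1+‖x‖²)) (2/(1+‖x‖²))^p x`. -/
theorem hasFDerivAt_two_div_one_add_norm_sq_rpow {E : Type*} [NormedAddCommGroup E]
    [InnerProductSpace ℝ E] (p : ℝ) (x : E) :
    HasFDerivAt (fun y : E => (2 / (1 + ‖y‖ ^ 2) : ℝ) ^ p)
      ((-(2 * p / (1 + ‖x‖ ^ 2)) * (2 / (1 + ‖x‖ ^ 2) : ℝ) ^ p) • innerSL ℝ x) x := by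
  have hpos : (0 : ℝ) < 1 + ‖x‖ ^ 2 := by positivity
  have hnorm : HasFDerivAt (fun y : E => 1 + ‖y‖ ^ 2) (2 • innerSL ℝ x) x :=
    (hasStrictFDerivAt_norm_sq x).hasFDerivAt.const_add 1
  have hreal : HasDerivAt (fun t : ℝ => (2 / t) ^ p)
      (-(p / (1 + ‖x‖ ^ 2)) * (2 / (1 + ‖x‖ ^ 2) : ℝ) ^ p) (1 + ‖x‖ ^ 2) := by
    have h := ((hasDerivAt_inv hpos.ne').const_mul 2).rpow_const (p := p)
      (Or.inl (by positivity))
    simp only [← div_eq_mul_inv] at h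
    convert h using 1
    rw [Real.rpow_sub_one (by positivity)]
    field_simp
  refine (hreal.comp_hasFDerivAt x hnorm).congr_fderiv ?_
  module

section Clifford

variable {n : ℕ} {H : Type*} [NormedAddCommGroup H] [InnerProductSpace ℝ H]
  (γ : EuclideanSpace ℝ (Fin n) →ₗ[ℝ] H →ₗ[ℝ] H)

/-- A Clifford multiplication squares to `-‖v‖²`. -/
theorem clifford_apply_apply_self
    (hcl : ∀ (v w : EuclideanSpace ℝ (Fin n)) (ψ : H),
      γ v (γ w ψ) + γ w (γ v ψ) = (-2 * ⟪v, w⟫) • ψ)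
    (v : EuclideanSpace ℝ (Fin n)) (ψ : H) : γ v (γ v ψ) = -(‖v‖ ^ 2) • ψ := by
  have h := hcl v v ψ
  rw [real_inner_self_eq_norm_sq, ← two_smul ℝ, neg_mul, ← mul_neg, mul_smul] at h
  exact smul_right_injective H (two_ne_zero' ℝ) h

theorem sum_inner_smul_clifford_single (x : EuclideanSpace ℝ (Fin n)) (ψ : H) :
    ∑ i, ⟪x, EuclideanSpace.single i (1 : ℝ)⟫ • γ (EuclideanSpace.single i (1 : ℝ)) ψ = γ x ψ := by
  have h := congrArg (fun v => γ v ψ) ((EuclideanSpace.basisFun (Fin n) ℝ).sum_repr' x)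
  simpa [real_inner_comm] using h

/-- The Leibniz rule for the Dirac operator applied to `f • (Φ + s γ(·)Φ)`, where the gradient of
`f` at `x` is `c x`. -/
theorem Dirac_smul_add_smul_clifford [FiniteDimensional ℝ H]
    (hcl : ∀ (v w : EuclideanSpace ℝ (Fin n)) (ψ : H),
      γ v (γ w ψ) + γ w (γ v ψ) = (-2 * ⟪v, w⟫) • ψ)
    {f : EuclideanSpace ℝ (Fin n) → ℝ} {c : ℝ} {x : EuclideanSpace ℝ (Fin n)}
    (hf : HasFDerivAt f (c • innerSL ℝ x) x) (s : ℝ) (Φ : H) :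
    Dirac γ (fun y => f y • (Φ + s • γ y Φ)) x =
      c • γ x (Φ + s • γ x Φ) - (n * s * f x) • Φ := by
  have hγ : HasFDerivAt (fun y => Φ + s • γ y Φ) (s • (γ.flip Φ).toContinuousLinearMap) x :=
    ((γ.flip Φ).toContinuousLinearMap.hasFDerivAt.const_smul s).const_add Φ
  have hsq (i : Fin n) : γ (EuclideanSpace.single i (1 : ℝ))
      (γ (EuclideanSpace.single i (1 : ℝ)) Φ) = -Φ := by
    simp [clifford_apply_apply_self γ hcl]
  have hterm (i : Fin n) : γ (EuclideanSpace.single i (1 : ℝ))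
      (fderiv ℝ (fun y => f y • (Φ + s • γ y Φ)) x (EuclideanSpace.single i (1 : ℝ))) =
      c • ⟪x, EuclideanSpace.single i (1 : ℝ)⟫ •
        γ (EuclideanSpace.single i (1 : ℝ)) (Φ + s • γ x Φ) - (s * f x) • Φ := by
    rw [(hf.fun_smul hγ).fderiv]
    simp only [add_apply, smul_apply,
      ContinuousLinearMap.smulRight_apply, innerSL_apply_apply, smul_eq_mul,
      LinearMap.coe_toContinuousLinearMap', LinearMap.flip_apply, map_add, map_smul, hsq]
    module
  rw [Dirac, Finset.sum_congr rfl fun i _ => hterm i, Finset.sum_sub_distrib, ← Finset.smul_sum,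
    sum_inner_smul_clifford_single, Finset.sum_const, Finset.card_univ, Fintype.card_fin]
  module

/-- The spinor bubble with sign `s = ±1` solves the conformally weighted Dirac equation. -/
theorem Dirac_spinor_bubble [FiniteDimensional ℝ H]
    (hcl : ∀ (v w : EuclideanSpace ℝ (Fin n)) (ψ : H),
      γ v (γ w ψ) + γ w (γ v ψ) = (-2 * ⟪v, w⟫) • ψ)
    {s : ℝ} (hs : s * s = 1) (Φ : H) (x : EuclideanSpace ℝ (Fin n)) :
    Dirac γ (fun y => (2 / (1 + ‖y‖ ^ 2) : ℝ) ^ ((n : ℝ) / 2) • (Φ + s • γ y Φ)) x =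
      (-(s * (n / (1 + ‖x‖ ^ 2)))) •
        (2 / (1 + ‖x‖ ^ 2) : ℝ) ^ ((n : ℝ) / 2) • (Φ + s • γ x Φ) := by
  rw [Dirac_smul_add_smul_clifford γ hcl (hasFDerivAt_two_div_one_add_norm_sq_rpow _ x)]
  have hpos : (1 + ‖x‖ ^ 2 : ℝ) ≠ 0 := by positivity
  simp only [map_add, map_smul, clifford_apply_apply_self γ hcl]
  generalize (2 / (1 + ‖x‖ ^ 2) : ℝ) ^ ((n : ℝ) / 2) = a
  match_scalars
  · field_simp
    linear_combination (n * a) * hs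
  · field_simp
    ring

end Clifford

/-- For `n ≥ 2` and `Φ ∈ H`, the Dirac operator applied to the spinor
bubbles satisfies `D ψ⁻_Φ(x) = (n/(1+‖x‖²)) ψ⁻_Φ(x)` and
`D ψ⁺_Φ(x) = −(n/(1+‖x‖²)) ψ⁺_Φ(x)` for every `x ∈ ℝⁿ`. -/
theorem dirac_of_spinor_bubbles {n : ℕ} {H : Type*} [NormedAddCommGroup H]
    [InnerProductSpace ℝ H] [FiniteDimensional ℝ H]
    (hn : 2 ≤ n)
    (γ : EuclideanSpace ℝ (Fin n) →ₗ[ℝ] H →ₗ[ℝ] H)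
    (hcl : ∀ (v w : EuclideanSpace ℝ (Fin n)) (ψ : H),
      γ v (γ w ψ) + γ w (γ v ψ) = (-2 * ⟪v, w⟫) • ψ)
    (hsk : ∀ (v : EuclideanSpace ℝ (Fin n)) (φ ψ : H),
      ⟪γ v φ, ψ⟫ = - ⟪φ, γ v ψ⟫)
    (Φ : H) (x : EuclideanSpace ℝ (Fin n)) :
    Dirac γ (psiNeg γ Φ) x = (((n : ℝ) / (1 + ‖x‖ ^ 2))) • psiNeg γ Φ x ∧
    Dirac γ (psiPos γ Φ) x = (-((n : ℝ) / (1 + ‖x‖ ^ 2))) • psiPos γ Φ x := by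
  constructor
  · have h := Dirac_spinor_bubble γ hcl (s := -1) (by norm_num) Φ x
    simp only [neg_smul, one_smul, ← sub_eq_add_neg, neg_mul, one_mul, neg_neg] at h
    exact h
  · have h := Dirac_spinor_bubble γ hcl (s := 1) (by norm_num) Φ x
    simp only [one_smul, one_mul] at h
    exact h
end
end

section
/- Let n ≥ 2 and let Φ ∈ H with Φ ≠ 0. Then ψ⁺_Φ satisfies the spinorial Yamabe equation with negative sign on ℝⁿ: for every x ∈ ℝⁿ, D ψ⁺_Φ(x) = −μ · ‖ψ⁺_Φ(x)‖^{2/(n−1)} · ψ⁺_Φ(x), where μ = n · 2^{−n/(n−1)} · ‖Φ‖^{−2/(n−1)} > 0. -/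
open scoped RealInnerProductSpace
open MeasureTheory

noncomputable section

/-- Clifford multiplication by `v` squares to `-‖v‖²`. -/
lemma clifford_apply_self {V H : Type*} [NormedAddCommGroup V] [InnerProductSpace ℝ V]
    [AddCommGroup H] [Module ℝ H] (γ : V →ₗ[ℝ] H →ₗ[ℝ] H)
    (hcl : ∀ (v w : V) (ψ : H), γ v (γ w ψ) + γ w (γ v ψ) = (-2 * ⟪v, w⟫) • ψ)
    (v : V) (ψ : H) : γ v (γ v ψ) = (-‖v‖ ^ 2) • ψ := by
  have h := hcl v v ψ
  rw [real_inner_self_eq_norm_sq, ← two_smul ℝ, mul_smul] at h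
  have h' := congrArg (fun y => (2⁻¹ : ℝ) • y) h
  simp only [smul_smul] at h'
  norm_num at h'
  simpa using h'

lemma norm_add_clifford_apply {V H : Type*} [NormedAddCommGroup V] [InnerProductSpace ℝ V]
    [NormedAddCommGroup H] [InnerProductSpace ℝ H] (γ : V →ₗ[ℝ] H →ₗ[ℝ] H)
    (hcl : ∀ (v w : V) (ψ : H), γ v (γ w ψ) + γ w (γ v ψ) = (-2 * ⟪v, w⟫) • ψ)
    (hsk : ∀ (v : V) (φ ψ : H), ⟪γ v φ, ψ⟫ = - ⟪φ, γ v ψ⟫)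
    (v : V) (ψ : H) : ‖ψ + γ v ψ‖ = (1 + ‖v‖ ^ 2) ^ (1 / 2 : ℝ) * ‖ψ‖ := by
  have h0 : ⟪ψ, γ v ψ⟫ = 0 := by
    have := hsk v ψ ψ
    rw [real_inner_comm] at this
    linarith
  have h1 : ‖γ v ψ‖ ^ 2 = ‖v‖ ^ 2 * ‖ψ‖ ^ 2 := by
    rw [← real_inner_self_eq_norm_sq, hsk, clifford_apply_self γ hcl, inner_smul_right,
      real_inner_self_eq_norm_sq]
    ring
  rw [← Real.sqrt_eq_rpow, ← sq_eq_sq₀ (norm_nonneg _) (by positivity), mul_pow,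
    Real.sq_sqrt (by positivity), norm_add_sq_real, h0, h1]
  ring

lemma hasFDerivAt_conformal_rpow {V : Type*} [NormedAddCommGroup V] [InnerProductSpace ℝ V]
    (p : ℝ) (x : V) :
    HasFDerivAt (fun y : V => (2 / (1 + ‖y‖ ^ 2) : ℝ) ^ p)
      ((-(2 * p / (1 + ‖x‖ ^ 2)) * (2 / (1 + ‖x‖ ^ 2)) ^ p) • innerSL ℝ x) x := by
  have hx : (0 : ℝ) < 1 + ‖x‖ ^ 2 := by positivity
  have h1 : HasFDerivAt (fun y : V => 1 + ‖y‖ ^ 2) ((2 : ℝ) • innerSL ℝ x) x := by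
    simpa [two_smul] using ((hasStrictFDerivAt_norm_sq x).hasFDerivAt.const_add 1)
  have h2 : HasDerivAt (fun t : ℝ => (2 / t) ^ p)
      (-(p / (1 + ‖x‖ ^ 2)) * (2 / (1 + ‖x‖ ^ 2)) ^ p) (1 + ‖x‖ ^ 2) := by
    have h : HasDerivAt (fun t : ℝ => 2 / t) (-2 / (1 + ‖x‖ ^ 2) ^ 2) (1 + ‖x‖ ^ 2) := by
      simpa [div_eq_mul_inv] using (hasDerivAt_inv hx.ne').const_mul (2 : ℝ)
    convert h.rpow_const (p := p) (Or.inl (by positivity)) using 1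
    rw [Real.rpow_sub_one (by positivity)]
    field_simp
  have h := h2.comp_hasFDerivAt x h1
  rw [smul_smul] at h
  refine h.congr_fderiv ?_
  congr 1
  ring

lemma dirac_psiPos {n : ℕ} {H : Type*} [NormedAddCommGroup H]
    [InnerProductSpace ℝ H]
    (γ : EuclideanSpace ℝ (Fin n) →ₗ[ℝ] H →ₗ[ℝ] H)
    (hcl : ∀ (v w : EuclideanSpace ℝ (Fin n)) (ψ : H),
      γ v (γ w ψ) + γ w (γ v ψ) = (-2 * ⟪v, w⟫) • ψ)
    (Φ : H) (x : EuclideanSpace ℝ (Fin n)) :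
    Dirac γ (psiPos γ Φ) x = (-(n / (1 + ‖x‖ ^ 2))) • psiPos γ Φ x := by
  have hlin : HasFDerivAt (fun y => Φ + γ y Φ) (LinearMap.toContinuousLinearMap (γ.flip Φ)) x :=
    (LinearMap.toContinuousLinearMap (γ.flip Φ)).hasFDerivAt.const_add Φ
  have hψ := (hasFDerivAt_conformal_rpow ((n : ℝ) / 2) x).smul hlin
  have hsum : ∀ w : H, ∑ i, x i • γ (EuclideanSpace.single i 1) w = γ x w := by
    intro w
    have h := congrArg (fun y => γ y w) ((EuclideanSpace.basisFun (Fin n) ℝ).sum_repr x)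
    simpa using h
  have hx : (0 : ℝ) < 1 + ‖x‖ ^ 2 := by positivity
  unfold Dirac
  rw [show fderiv ℝ (psiPos γ Φ) x = _ from hψ.fderiv]
  set f := (2 / (1 + ‖x‖ ^ 2)) ^ ((n : ℝ) / 2) with hf
  set c := -(2 * ((n : ℝ) / 2) / (1 + ‖x‖ ^ 2)) * f with hc
  have hterm : ∀ i : Fin n, γ (EuclideanSpace.single i 1)
      ((f • LinearMap.toContinuousLinearMap (γ.flip Φ) +
        (c • innerSL ℝ x).smulRight (Φ + γ x Φ)) (EuclideanSpace.single i 1)) =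
      (-f) • Φ + c • (x i • γ (EuclideanSpace.single i 1) (Φ + γ x Φ)) := by
    intro i
    simp [EuclideanSpace.inner_single_right, clifford_apply_self γ hcl, mul_smul]
  rw [Finset.sum_congr rfl fun i _ => hterm i, Finset.sum_add_distrib,
    ← Finset.smul_sum (r := c), hsum,
    map_add, clifford_apply_self γ hcl, psiPos, ← hf]
  simp only [Finset.sum_const, Finset.card_univ, Fintype.card_fin, ← Nat.cast_smul_eq_nsmul ℝ]
  match_scalars <;> (rw [hc]; field_simp; try ring)

/-- For `n ≥ 2` and `0 ≠ Φ ∈ H`, the spinor bubble `ψ⁺_Φ` solves the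
spinorial Yamabe equation with negative sign, `D ψ⁺_Φ = −μ ‖ψ⁺_Φ‖^{2/(n−1)} ψ⁺_Φ`
on `ℝⁿ`, with `μ = n · 2^{−n/(n−1)} · ‖Φ‖^{−2/(n−1)} > 0`. -/
theorem psiPos_solves_spinorial_yamabe_neg {n : ℕ} {H : Type*} [NormedAddCommGroup H]
    [InnerProductSpace ℝ H] [FiniteDimensional ℝ H]
    (hn : 2 ≤ n)
    (γ : EuclideanSpace ℝ (Fin n) →ₗ[ℝ] H →ₗ[ℝ] H)
    (hcl : ∀ (v w : EuclideanSpace ℝ (Fin n)) (ψ : H),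
      γ v (γ w ψ) + γ w (γ v ψ) = (-2 * ⟪v, w⟫) • ψ)
    (hsk : ∀ (v : EuclideanSpace ℝ (Fin n)) (φ ψ : H),
      ⟪γ v φ, ψ⟫ = - ⟪φ, γ v ψ⟫)
    (Φ : H) (hΦ : Φ ≠ 0) :
    (0 : ℝ) < (n : ℝ) * (2 : ℝ) ^ (-(n : ℝ) / ((n : ℝ) - 1)) *
        ‖Φ‖ ^ (-(2 : ℝ) / ((n : ℝ) - 1)) ∧
    ∀ x : EuclideanSpace ℝ (Fin n),
      Dirac γ (psiPos γ Φ) x =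
        (-(((n : ℝ) * (2 : ℝ) ^ (-(n : ℝ) / ((n : ℝ) - 1)) *
            ‖Φ‖ ^ (-(2 : ℝ) / ((n : ℝ) - 1))) *
          ‖psiPos γ Φ x‖ ^ ((2 : ℝ) / ((n : ℝ) - 1)))) • psiPos γ Φ x := by
  have hn1 : (0 : ℝ) < (n : ℝ) - 1 := by
    have : (2 : ℝ) ≤ n := by exact_mod_cast hn
    linarith
  have hΦ' : 0 < ‖Φ‖ := norm_pos_iff.mpr hΦ
  refine ⟨by positivity, fun x => ?_⟩
  rw [dirac_psiPos γ hcl]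
  congr 2
  have hx : (0 : ℝ) < 1 + ‖x‖ ^ 2 := by positivity
  have hnorm : ‖psiPos γ Φ x‖ ^ ((2 : ℝ) / ((n : ℝ) - 1)) =
      (2 : ℝ) ^ ((n : ℝ) / ((n : ℝ) - 1)) * (1 + ‖x‖ ^ 2)⁻¹ *
        ‖Φ‖ ^ ((2 : ℝ) / ((n : ℝ) - 1)) := by
    rw [psiPos, norm_smul, norm_add_clifford_apply γ hcl hsk, Real.norm_of_nonneg (by positivity),
      Real.div_rpow (by norm_num) hx.le, div_mul_eq_mul_div, mul_div_assoc, mul_div_right_comm,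
      ← Real.rpow_sub hx, ← mul_assoc, Real.mul_rpow (by positivity) (by positivity),
      Real.mul_rpow (by positivity) (by positivity), ← Real.rpow_mul (by norm_num),
      ← Real.rpow_mul hx.le, ← Real.rpow_neg_one]
    congr 3 <;> (field_simp; try ring)
  rw [hnorm, neg_div, neg_div, Real.rpow_neg (by norm_num), Real.rpow_neg hΦ'.le]
  field_simp
end
end

section
/- Let n ≥ 2, let Φ₀ ∈ H with Φ₀ ≠ 0, and set φ̃ = ψ⁻_{Φ₀} + ψ⁺_{γ(e₁)Φ₀}. Then φ̃ violates the conjectured sharp constant of the second spinorial Sobolev inequality: (∫_{ℝⁿ} ‖Dφ̃(x)‖^{2n/(n+1)} dx)^{(n+1)/n} < (n²/4) · ωₙ^{2/n} · (∫_{ℝⁿ} ‖φ̃(x)‖^{2n/(n−1)} dx)^{(n−1)/n}, where both integrals are finite. In particular the infimum of the quotient (∫‖Dψ‖^{2n/(n+1)})^{(n+1)/n} / (∫‖ψ‖^{2n/(n−1)})^{(n−1)/n} over nonzero ψ is strictly less than (n²/4)ωₙ^{2/n}. -/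
open scoped RealInnerProductSpace
open MeasureTheory

noncomputable section

/-- The volume `ωₙ = 2 π^{(n+1)/2} / Γ((n+1)/2)` of the round unit `n`-sphere. -/
def sphereVol (n : ℕ) : ℝ :=
  2 * Real.pi ^ (((n : ℝ) + 1) / 2) / Real.Gamma (((n : ℝ) + 1) / 2)

/-- The conformal factor `2/(1+‖x‖²)` of the round metric in stereographic coordinates. -/
def conformalFactor {n : ℕ} (x : EuclideanSpace ℝ (Fin n)) : ℝ := 2 / (1 + ‖x‖ ^ 2)

section ConformalFactor

variable {n : ℕ}

lemma conformalFactor_pos (x : EuclideanSpace ℝ (Fin n)) : 0 < conformalFactor x := by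
  unfold conformalFactor; positivity

lemma conformalFactor_mul (x : EuclideanSpace ℝ (Fin n)) :
    conformalFactor x * (1 + ‖x‖ ^ 2) = 2 := by
  unfold conformalFactor; field_simp

lemma conformalFactor_neg (x : EuclideanSpace ℝ (Fin n)) :
    conformalFactor (-x) = conformalFactor x := by
  simp [conformalFactor]

lemma continuous_conformalFactor :
    Continuous (conformalFactor : EuclideanSpace ℝ (Fin n) → ℝ) := by
  unfold conformalFactor
  exact continuous_const.div (by fun_prop) fun x => by positivity

lemma abs_conformalFactor_mul_apply_le (x : EuclideanSpace ℝ (Fin n)) (i : Fin n) :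
    |conformalFactor x * x i| ≤ 1 := by
  have h1 : |x i| ≤ ‖x‖ := by simpa using PiLp.norm_apply_le x i
  rw [abs_mul, abs_of_pos (conformalFactor_pos x)]
  calc conformalFactor x * |x i| ≤ conformalFactor x * ‖x‖ := by
        gcongr; exact (conformalFactor_pos x).le
    _ ≤ 1 := by
        rw [conformalFactor, div_mul_eq_mul_div, div_le_one (by positivity)]
        nlinarith [sq_nonneg (1 - ‖x‖)]

lemma hasFDerivAt_conformalFactor_rpow (p : ℝ) (x : EuclideanSpace ℝ (Fin n)) :
    HasFDerivAt (fun y => conformalFactor y ^ p)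
      ((-p * conformalFactor x ^ (p + 1)) • innerSL ℝ x) x := by
  have h1 : HasFDerivAt (fun y : EuclideanSpace ℝ (Fin n) => 1 + ‖y‖ ^ 2)
      (2 • innerSL ℝ x) x := ((hasStrictFDerivAt_norm_sq x).hasFDerivAt).const_add 1
  have hne : 1 + ‖x‖ ^ 2 ≠ 0 := by positivity
  have h2 : HasDerivAt (fun t : ℝ => 2 / t) (-2 / (1 + ‖x‖ ^ 2) ^ 2) (1 + ‖x‖ ^ 2) := by
    simpa [div_eq_mul_inv] using (hasDerivAt_inv hne).const_mul 2
  have h3 : HasFDerivAt (conformalFactor : EuclideanSpace ℝ (Fin n) → ℝ) _ x :=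
    h2.comp_hasFDerivAt x h1
  have h4 := h3.rpow_const (p := p) (Or.inl (conformalFactor_pos x).ne')
  refine h4.congr_fderiv ?_
  rw [← Nat.cast_smul_eq_nsmul ℝ, smul_smul, smul_smul]
  congr 1
  have hp : conformalFactor x ^ (p + 1) = conformalFactor x ^ (p - 1) * conformalFactor x ^ 2 := by
    rw [← Real.rpow_natCast, ← Real.rpow_add (conformalFactor_pos x)]
    congr 1; push_cast; ring
  rw [hp]
  generalize conformalFactor x ^ (p - 1) = c
  unfold conformalFactor
  push_cast
  field_simp

lemma integral_one_add_norm_sq_pow_inv (hn : 0 < n) :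
    ∫ x : EuclideanSpace ℝ (Fin n), ((1 + ‖x‖ ^ 2) ^ n)⁻¹ =
      Real.pi ^ ((n : ℝ) / 2) * Real.Gamma ((n : ℝ) / 2) / Real.Gamma n := by
  have hn' : (0 : ℝ) < n := by exact_mod_cast hn
  let F : ℝ → EuclideanSpace ℝ (Fin n) → ℝ := fun t x =>
    t ^ ((n : ℝ) - 1) * Real.exp (-((1 + ‖x‖ ^ 2) * t))
  have hx : ∀ x : EuclideanSpace ℝ (Fin n),
      ∫ t in Set.Ioi 0, F t x = Real.Gamma n * ((1 + ‖x‖ ^ 2) ^ n)⁻¹ := fun x => by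
    have := Real.integral_rpow_mul_exp_neg_mul_Ioi hn' (r := 1 + ‖x‖ ^ 2) (by positivity)
    simp only [F]
    rw [this, Real.rpow_natCast, one_div, inv_pow, mul_comm]
  have hF : ∀ t x, F t x = t ^ ((n : ℝ) - 1) * Real.exp (-t) * Real.exp (-t * ‖x‖ ^ 2) := by
    intro t x
    simp only [F]
    rw [mul_assoc, ← Real.exp_add]
    ring_nf
  have hgauss : ∀ t : ℝ, 0 < t →
      ∫ x : EuclideanSpace ℝ (Fin n), Real.exp (-t * ‖x‖ ^ 2) =
        (Real.pi / t) ^ ((n : ℝ) / 2) := fun t ht => by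
    simpa using GaussianFourier.integral_rexp_neg_mul_sq_norm
      (V := EuclideanSpace ℝ (Fin n)) ht
  have ht : ∀ t : ℝ, 0 < t → ∫ x, F t x =
      Real.pi ^ ((n : ℝ) / 2) * (Real.exp (-t) * t ^ ((n : ℝ) / 2 - 1)) := fun t ht => by
    simp only [hF]
    rw [integral_const_mul, hgauss t ht, Real.div_rpow Real.pi_pos.le ht.le,
      show (n : ℝ) - 1 = ((n : ℝ) / 2 - 1) + (n : ℝ) / 2 by ring, Real.rpow_add ht]
    have := (Real.rpow_pos_of_pos ht ((n : ℝ) / 2)).ne'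
    field_simp
  have hint : Integrable (Function.uncurry F)
      ((volume.restrict (Set.Ioi (0 : ℝ))).prod volume) := by
    rw [integrable_prod_iff]
    · refine ⟨(ae_restrict_iff' measurableSet_Ioi).2 (.of_forall fun t ht => ?_), ?_⟩
      · simp only [Function.uncurry_apply_pair, hF]
        refine Integrable.const_mul (.of_integral_ne_zero ?_) _
        rw [hgauss t ht]
        exact (Real.rpow_pos_of_pos (div_pos Real.pi_pos ht) _).ne'
      · have := (Real.GammaIntegral_convergent (half_pos hn')).const_mul
          (Real.pi ^ ((n : ℝ) / 2))
        refine IntegrableOn.congr_fun this (fun t h0 => ?_) measurableSet_Ioi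
        simp only [Function.uncurry_apply_pair]
        rw [← ht t h0]
        refine integral_congr_ae (.of_forall fun x => ?_)
        have h0' : (0 : ℝ) < t := h0
        simp only [F]
        rw [Real.norm_of_nonneg (by positivity)]
    · refine Measurable.aestronglyMeasurable ?_
      simp only [F, Function.uncurry_def]
      fun_prop
  have key := integral_integral_swap hint
  simp only [hx] at key
  rw [setIntegral_congr_fun measurableSet_Ioi ht, integral_const_mul, integral_const_mul,
    ← Real.Gamma_eq_integral (half_pos hn')] at key
  rw [key, mul_div_cancel_left₀ _ (Real.Gamma_pos_of_pos hn').ne']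

/-- The conformal volume of `ℝⁿ` is the volume of the round sphere. -/
lemma integral_conformalFactor_pow (hn : 0 < n) :
    ∫ x : EuclideanSpace ℝ (Fin n), conformalFactor x ^ n = sphereVol n := by
  have hn' : (0 : ℝ) < n := by exact_mod_cast hn
  simp only [conformalFactor, div_pow, div_eq_mul_inv (_ ^ n : ℝ)]
  rw [integral_const_mul, integral_one_add_norm_sq_pow_inv hn, sphereVol]
  have h := Real.Gamma_mul_Gamma_add_half ((n : ℝ) / 2)
  rw [mul_div_cancel₀ _ (two_ne_zero' ℝ), ← add_div] at h
  have h1 := Real.Gamma_pos_of_pos hn'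
  have h2 := Real.Gamma_pos_of_pos (show 0 < ((n : ℝ) + 1) / 2 by positivity)
  rw [add_div, Real.rpow_add Real.pi_pos, ← add_div, ← Real.sqrt_eq_rpow, ← mul_div_assoc,
    div_eq_div_iff h1.ne' h2.ne']
  have h3 : (2 : ℝ) ^ n * 2 ^ (1 - (n : ℝ)) = 2 := by
    rw [← Real.rpow_natCast, ← Real.rpow_add two_pos]; simp
  linear_combination (2 : ℝ) ^ n * Real.pi ^ ((n : ℝ) / 2) * h +
    Real.pi ^ ((n : ℝ) / 2) * Real.Gamma n * √Real.pi * h3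

lemma sphereVol_pos (n : ℕ) : 0 < sphereVol n := by
  have := Real.Gamma_pos_of_pos (show 0 < ((n : ℝ) + 1) / 2 by positivity)
  unfold sphereVol
  positivity

lemma integrable_conformalFactor_pow (hn : 0 < n) :
    Integrable fun x : EuclideanSpace ℝ (Fin n) => conformalFactor x ^ n :=
  .of_integral_ne_zero (by rw [integral_conformalFactor_pow hn]; exact (sphereVol_pos n).ne')

lemma integrable_conformalFactor_pow_mul (hn : 0 < n) {g : EuclideanSpace ℝ (Fin n) → ℝ}
    (hg : Continuous g) {C : ℝ} (hC : ∀ x, |g x| ≤ C) :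
    Integrable fun x => conformalFactor x ^ n * g x :=
  (integrable_conformalFactor_pow hn).mul_bdd hg.aestronglyMeasurable (.of_forall hC)

lemma continuous_conformalFactor_mul_apply (i : Fin n) :
    Continuous fun x : EuclideanSpace ℝ (Fin n) => conformalFactor x * x i :=
  continuous_conformalFactor.mul (by fun_prop)

lemma integrable_conformalFactor_pow_mul_comp (i : Fin n) {g : ℝ → ℝ} (hg : Continuous g) :
    Integrable fun x : EuclideanSpace ℝ (Fin n) =>
      conformalFactor x ^ n * g (conformalFactor x * x i) := by
  obtain ⟨C, hC⟩ := (isCompact_Icc (a := (-1 : ℝ)) (b := 1)).exists_bound_of_continuousOn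
    hg.continuousOn
  exact integrable_conformalFactor_pow_mul i.pos
    (hg.comp (continuous_conformalFactor_mul_apply i))
    fun x => hC _ (abs_le.1 (abs_conformalFactor_mul_apply_le x i))

lemma integral_conformalFactor_pow_mul_apply (i : Fin n) :
    ∫ x : EuclideanSpace ℝ (Fin n), conformalFactor x ^ n * (conformalFactor x * x i) = 0 := by
  have h := integral_neg_eq_self
    (fun x : EuclideanSpace ℝ (Fin n) => conformalFactor x ^ n * (conformalFactor x * x i)) volume
  simp only [conformalFactor_neg, PiLp.neg_apply, mul_neg, integral_neg] at h
  linarith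

lemma integral_conformalFactor_pow_mul_affine (i : Fin n) (c : ℝ) :
    ∫ x : EuclideanSpace ℝ (Fin n),
      conformalFactor x ^ n * (1 + c * (conformalFactor x * x i)) = sphereVol n := by
  have h1 := integrable_conformalFactor_pow i.pos
  have h2 := integrable_conformalFactor_pow_mul_comp i (g := fun s => c * s) (by fun_prop)
  simp only [mul_add, mul_one]
  rw [integral_add h1 h2, integral_conformalFactor_pow i.pos]
  simp only [mul_left_comm _ c]
  rw [integral_const_mul, integral_conformalFactor_pow_mul_apply, mul_zero, add_zero]

lemma integral_conformalFactor_pow_mul_rpow_le (i : Fin n) {q : ℝ} (h0 : 0 ≤ q) (h1 : q ≤ 1) :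
    ∫ x : EuclideanSpace ℝ (Fin n),
      conformalFactor x ^ n * (1 + conformalFactor x * x i) ^ q ≤ sphereVol n := by
  rw [← integral_conformalFactor_pow_mul_affine i q]
  refine integral_mono
    (integrable_conformalFactor_pow_mul_comp i (g := fun s => (1 + s) ^ q)
      ((by fun_prop : Continuous fun s : ℝ => 1 + s).rpow_const fun _ => .inr h0))
    (integrable_conformalFactor_pow_mul_comp i (g := fun s => 1 + q * s) (by fun_prop))
    fun x => ?_
  exact mul_le_mul_of_nonneg_left
    (rpow_one_add_le_one_add_mul_self (abs_le.1 (abs_conformalFactor_mul_apply_le x i)).1 h0 h1)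
    (pow_pos (conformalFactor_pos x) n).le

lemma lt_integral_conformalFactor_pow_mul_rpow (i : Fin n) {p : ℝ} (h1 : 1 < p) :
    sphereVol n < ∫ x : EuclideanSpace ℝ (Fin n),
      conformalFactor x ^ n * (1 - conformalFactor x * x i) ^ p := by
  have hc1 : Continuous fun s : ℝ => (1 - s) ^ p :=
    (by fun_prop : Continuous fun s : ℝ => 1 - s).rpow_const fun _ => .inr (by linarith)
  have hi1 := integrable_conformalFactor_pow_mul_comp i hc1
  have hi2 := integrable_conformalFactor_pow_mul_comp i (g := fun s => 1 + (-p) * s) (by fun_prop)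
  rw [← integral_conformalFactor_pow_mul_affine i (-p), ← sub_pos, ← integral_sub hi1 hi2]
  have hs : ∀ x : EuclideanSpace ℝ (Fin n), -1 ≤ -(conformalFactor x * x i) := fun x =>
    neg_le_neg (abs_le.1 (abs_conformalFactor_mul_apply_le x i)).2
  have hw : ∀ x : EuclideanSpace ℝ (Fin n), 0 < conformalFactor x ^ n := fun x =>
    pow_pos (conformalFactor_pos x) n
  refine integral_pos_of_integrable_nonneg_nonzero (x := EuclideanSpace.single i 1) ?_
    (hi1.sub hi2) (fun x => ?_) ?_
  · have hcw := (continuous_conformalFactor (n := n)).pow n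
    have hcs := continuous_conformalFactor_mul_apply i
    exact (hcw.mul (hc1.comp hcs)).sub (hcw.mul (continuous_const.add (hcs.const_mul _)))
  · rw [Pi.zero_apply, ← mul_sub]
    refine mul_nonneg (hw x).le (sub_nonneg.2 ?_)
    have := one_add_mul_self_le_rpow_one_add (hs x) h1.le
    simpa [sub_eq_add_neg] using this
  · rw [← mul_sub]
    refine mul_ne_zero (hw _).ne' (sub_pos.2 ?_).ne'
    have := one_add_mul_self_lt_rpow_one_add (hs (EuclideanSpace.single i 1))
      (by simpa using (conformalFactor_pos _).ne') h1
    simpa [sub_eq_add_neg] using this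

end ConformalFactor

section Clifford

variable {n : ℕ} {H : Type*} [NormedAddCommGroup H] [InnerProductSpace ℝ H]
  {γ : EuclideanSpace ℝ (Fin n) →ₗ[ℝ] H →ₗ[ℝ] H}

lemma clifford_sq
    (hcl : ∀ (v w : EuclideanSpace ℝ (Fin n)) (ψ : H),
      γ v (γ w ψ) + γ w (γ v ψ) = (-2 * ⟪v, w⟫) • ψ)
    (v : EuclideanSpace ℝ (Fin n)) (ψ : H) : γ v (γ v ψ) = (-‖v‖ ^ 2) • ψ := by
  have h := hcl v v ψ
  rw [← two_smul ℝ, real_inner_self_eq_norm_sq, show -2 * ‖v‖ ^ 2 = 2 * -‖v‖ ^ 2 by ring,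
    mul_smul] at h
  exact smul_right_injective H (two_ne_zero' ℝ) h

lemma inner_clifford_clifford
    (hcl : ∀ (v w : EuclideanSpace ℝ (Fin n)) (ψ : H),
      γ v (γ w ψ) + γ w (γ v ψ) = (-2 * ⟪v, w⟫) • ψ)
    (hsk : ∀ (v : EuclideanSpace ℝ (Fin n)) (φ ψ : H), ⟪γ v φ, ψ⟫ = - ⟪φ, γ v ψ⟫)
    (v w : EuclideanSpace ℝ (Fin n)) (ψ : H) :
    ⟪γ v ψ, γ w ψ⟫ = ⟪v, w⟫ * ‖ψ‖ ^ 2 := by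
  have h1 := congrArg (fun y => ⟪ψ, y⟫) (hcl v w ψ)
  simp only [inner_add_right, inner_smul_right, real_inner_self_eq_norm_sq] at h1
  have h2 := hsk v ψ (γ w ψ)
  have h3 := hsk w ψ (γ v ψ)
  rw [real_inner_comm] at h3
  linarith

lemma inner_clifford_self
    (hsk : ∀ (v : EuclideanSpace ℝ (Fin n)) (φ ψ : H), ⟪γ v φ, ψ⟫ = - ⟪φ, γ v ψ⟫)
    (v : EuclideanSpace ℝ (Fin n)) (ψ : H) : ⟪ψ, γ v ψ⟫ = 0 := by
  have h := hsk v ψ ψ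
  rw [real_inner_comm] at h
  linarith

lemma norm_sq_clifford
    (hcl : ∀ (v w : EuclideanSpace ℝ (Fin n)) (ψ : H),
      γ v (γ w ψ) + γ w (γ v ψ) = (-2 * ⟪v, w⟫) • ψ)
    (hsk : ∀ (v : EuclideanSpace ℝ (Fin n)) (φ ψ : H), ⟪γ v φ, ψ⟫ = - ⟪φ, γ v ψ⟫)
    (v : EuclideanSpace ℝ (Fin n)) (ψ : H) : ‖γ v ψ‖ ^ 2 = ‖v‖ ^ 2 * ‖ψ‖ ^ 2 := by
  rw [← real_inner_self_eq_norm_sq, inner_clifford_clifford hcl hsk, real_inner_self_eq_norm_sq]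

/-- Squared norms of `α + γ(x)β` and `β + γ(x)α` for `α = Φ + γ(eᵢ)Φ` and `β = γ(eᵢ)Φ - Φ`. -/
lemma norm_sq_clifford_affine
    (hcl : ∀ (v w : EuclideanSpace ℝ (Fin n)) (ψ : H),
      γ v (γ w ψ) + γ w (γ v ψ) = (-2 * ⟪v, w⟫) • ψ)
    (hsk : ∀ (v : EuclideanSpace ℝ (Fin n)) (φ ψ : H), ⟪γ v φ, ψ⟫ = - ⟪φ, γ v ψ⟫)
    (i : Fin n) (Φ : H) (x : EuclideanSpace ℝ (Fin n)) {α β : H}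
    (hα : α = Φ + γ (EuclideanSpace.single i 1) Φ)
    (hβ : β = γ (EuclideanSpace.single i 1) Φ - Φ) :
    ‖α + γ x β‖ ^ 2 = 2 * ‖Φ‖ ^ 2 * (1 + ‖x‖ ^ 2 - 2 * x i) ∧
    ‖β + γ x α‖ ^ 2 = 2 * ‖Φ‖ ^ 2 * (1 + ‖x‖ ^ 2 + 2 * x i) := by
  set Ψ := γ (EuclideanSpace.single i 1) Φ with hΨ
  have hΨn : ‖Ψ‖ ^ 2 = ‖Φ‖ ^ 2 := by simp [hΨ, norm_sq_clifford hcl hsk]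
  have h0 : ⟪Φ, Ψ⟫ = 0 := inner_clifford_self hsk _ _
  have hαn : ‖α‖ ^ 2 = 2 * ‖Φ‖ ^ 2 := by rw [hα, norm_add_sq_real, h0, hΨn]; ring
  have hβn : ‖β‖ ^ 2 = 2 * ‖Φ‖ ^ 2 := by
    rw [hβ, norm_sub_sq_real, real_inner_comm, h0, hΨn]; ring
  have hx : ⟪γ x Φ, Ψ⟫ = x i * ‖Φ‖ ^ 2 := by
    rw [hΨ, inner_clifford_clifford hcl hsk]
    simp [EuclideanSpace.inner_single_right]
  have h1 : ⟪Φ, γ x Ψ⟫ = -(x i * ‖Φ‖ ^ 2) := by linarith [hsk x Φ Ψ]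
  have h2 : ⟪Ψ, γ x Φ⟫ = x i * ‖Φ‖ ^ 2 := by rw [real_inner_comm, hx]
  have h3 := inner_clifford_self hsk x Φ
  have h4 := inner_clifford_self hsk x Ψ
  have h5 : ⟪α, γ x β⟫ = -2 * (x i * ‖Φ‖ ^ 2) := by
    rw [hα, hβ, map_sub, inner_sub_right, inner_add_left, inner_add_left, h1, h2, h3, h4]; ring
  have h6 : ⟪β, γ x α⟫ = 2 * (x i * ‖Φ‖ ^ 2) := by
    linarith [hsk x β α, real_inner_comm α (γ x β)]
  constructor
  · rw [norm_add_sq_real, norm_sq_clifford hcl hsk, h5, hαn, hβn]; ring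
  · rw [norm_add_sq_real, norm_sq_clifford hcl hsk, h6, hαn, hβn]; ring

lemma hasFDerivAt_conformal_spinor (α β : H) (x : EuclideanSpace ℝ (Fin n)) :
    HasFDerivAt (fun y => conformalFactor y ^ ((n : ℝ) / 2) • (α + γ y β))
      (conformalFactor x ^ ((n : ℝ) / 2) • LinearMap.toContinuousLinearMap (γ.flip β) +
        ((-((n : ℝ) / 2) * conformalFactor x ^ ((n : ℝ) / 2 + 1)) • innerSL ℝ x).smulRight
          (α + γ x β)) x := by
  have h1 : HasFDerivAt (fun y => α + γ y β) (LinearMap.toContinuousLinearMap (γ.flip β)) x :=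
    ((LinearMap.toContinuousLinearMap (γ.flip β)).hasFDerivAt).const_add α
  exact (hasFDerivAt_conformalFactor_rpow ((n : ℝ) / 2) x).smul h1

lemma dirac_conformal_spinor
    (hcl : ∀ (v w : EuclideanSpace ℝ (Fin n)) (ψ : H),
      γ v (γ w ψ) + γ w (γ v ψ) = (-2 * ⟪v, w⟫) • ψ)
    (α β : H) (x : EuclideanSpace ℝ (Fin n)) :
    Dirac γ (fun y => conformalFactor y ^ ((n : ℝ) / 2) • (α + γ y β)) x =
      (-((n : ℝ) / 2) * conformalFactor x ^ ((n : ℝ) / 2 + 1)) • (β + γ x α) := by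
  have hsum : ∑ i, x i • EuclideanSpace.single i (1 : ℝ) = x := by
    ext j; simp [Finset.sum_apply, Pi.single_apply]
  have hsum' : ∀ ψ : H, ∑ i, x i • γ (EuclideanSpace.single i (1 : ℝ)) ψ = γ x ψ := fun ψ => by
    conv_rhs => rw [← hsum]
    simp
  have hterm : ∀ i, γ (EuclideanSpace.single i (1 : ℝ))
      (fderiv ℝ (fun y => conformalFactor y ^ ((n : ℝ) / 2) • (α + γ y β)) x
        (EuclideanSpace.single i (1 : ℝ))) =
      -(conformalFactor x ^ ((n : ℝ) / 2) • β) +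
        (-((n : ℝ) / 2) * conformalFactor x ^ ((n : ℝ) / 2 + 1)) •
          (x i • γ (EuclideanSpace.single i (1 : ℝ)) (α + γ x β)) := fun i => by
    rw [(hasFDerivAt_conformal_spinor α β x).fderiv]
    simp [clifford_sq hcl, EuclideanSpace.inner_single_right, mul_smul]
  rw [Dirac, Finset.sum_congr rfl fun i _ => hterm i, Finset.sum_add_distrib, ← Finset.smul_sum,
    hsum', map_add, clifford_sq hcl, Finset.sum_const, Finset.card_univ, Fintype.card_fin]
  have hw : conformalFactor x ^ ((n : ℝ) / 2) =
      conformalFactor x ^ ((n : ℝ) / 2 + 1) * ((1 + ‖x‖ ^ 2) / 2) := by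
    rw [Real.rpow_add_one (conformalFactor_pos x).ne', mul_assoc, ← mul_div_assoc,
      conformalFactor_mul]
    simp
  rw [hw, ← Nat.cast_smul_eq_nsmul ℝ]
  module

lemma norm_conformal_spinor_rpow {r : ℝ} {v : H} {x : EuclideanSpace ℝ (Fin n)} {C t p q a b : ℝ}
    (hC : 0 ≤ C) (ht : 0 ≤ t) (hv : ‖v‖ ^ 2 = C * (1 + ‖x‖ ^ 2) * t) (hq : q = 2 * p)
    (ha : (2 * a - 1) * p = b) (hr : r ^ 2 = conformalFactor x ^ (2 * a)) :
    ‖r • v‖ ^ q = (2 * C) ^ p * (conformalFactor x ^ b * t ^ p) := by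
  have hw := conformalFactor_pos x
  have h : ‖r • v‖ ^ 2 = 2 * C * (conformalFactor x ^ (2 * a - 1) * t) := by
    rw [norm_smul, mul_pow, Real.norm_eq_abs, sq_abs, hr, hv,
      show (2 * a) = (2 * a - 1) + 1 by ring, Real.rpow_add_one hw.ne', add_sub_cancel_right]
    linear_combination C * t * conformalFactor x ^ (2 * a - 1) * conformalFactor_mul x
  rw [hq, Real.rpow_mul (norm_nonneg _), Real.rpow_two, h,
    Real.mul_rpow (by positivity) (by positivity), Real.mul_rpow (by positivity) ht,
    ← Real.rpow_mul hw.le, ha]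

end Clifford

/-- For `n ≥ 2` and `0 ≠ Φ₀ ∈ H`, the spinor field
`φ̃ = ψ⁻_{Φ₀} + ψ⁺_{γ(e₁)Φ₀}` violates the conjectured sharp constant of the
second spinorial Sobolev inequality:
`(∫ ‖Dφ̃‖^{2n/(n+1)})^{(n+1)/n} < (n²/4) ωₙ^{2/n} (∫ ‖φ̃‖^{2n/(n−1)})^{(n−1)/n}`,
with both integrals finite; in particular the infimum of the quotient
`(∫ ‖Dψ‖^{2n/(n+1)})^{(n+1)/n} / (∫ ‖ψ‖^{2n/(n−1)})^{(n−1)/n}` over nonzero `ψ`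
is strictly below `(n²/4) ωₙ^{2/n}`. -/
theorem bubble_combination_below_conjectured_constant {n : ℕ} {H : Type*}
    [NormedAddCommGroup H] [InnerProductSpace ℝ H] [FiniteDimensional ℝ H]
    (hn : 2 ≤ n)
    (γ : EuclideanSpace ℝ (Fin n) →ₗ[ℝ] H →ₗ[ℝ] H)
    (hcl : ∀ (v w : EuclideanSpace ℝ (Fin n)) (ψ : H),
      γ v (γ w ψ) + γ w (γ v ψ) = (-2 * ⟪v, w⟫) • ψ)
    (hsk : ∀ (v : EuclideanSpace ℝ (Fin n)) (φ ψ : H),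
      ⟪γ v φ, ψ⟫ = - ⟪φ, γ v ψ⟫)
    (Φ₀ : H) (hΦ : Φ₀ ≠ 0)
    (φt : EuclideanSpace ℝ (Fin n) → H)
    (hφt : φt = fun x => psiNeg γ Φ₀ x +
      psiPos γ (γ (EuclideanSpace.single (⟨0, by omega⟩ : Fin n) (1 : ℝ)) Φ₀) x) :
    Integrable (fun x : EuclideanSpace ℝ (Fin n) =>
      ‖Dirac γ φt x‖ ^ (2 * (n : ℝ) / ((n : ℝ) + 1))) ∧
    Integrable (fun x : EuclideanSpace ℝ (Fin n) =>
      ‖φt x‖ ^ (2 * (n : ℝ) / ((n : ℝ) - 1))) ∧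
    (∫ x : EuclideanSpace ℝ (Fin n),
        ‖Dirac γ φt x‖ ^ (2 * (n : ℝ) / ((n : ℝ) + 1))) ^ (((n : ℝ) + 1) / (n : ℝ)) <
      (n : ℝ) ^ 2 / 4 * sphereVol n ^ ((2 : ℝ) / (n : ℝ)) *
        (∫ x : EuclideanSpace ℝ (Fin n),
          ‖φt x‖ ^ (2 * (n : ℝ) / ((n : ℝ) - 1))) ^ (((n : ℝ) - 1) / (n : ℝ)) ∧
    sInf { r : ℝ | ∃ ψ : EuclideanSpace ℝ (Fin n) → H, Differentiable ℝ ψ ∧ ψ ≠ 0 ∧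
        Integrable (fun x : EuclideanSpace ℝ (Fin n) =>
          ‖Dirac γ ψ x‖ ^ (2 * (n : ℝ) / ((n : ℝ) + 1))) ∧
        Integrable (fun x : EuclideanSpace ℝ (Fin n) =>
          ‖ψ x‖ ^ (2 * (n : ℝ) / ((n : ℝ) - 1))) ∧
        r = (∫ x : EuclideanSpace ℝ (Fin n),
              ‖Dirac γ ψ x‖ ^ (2 * (n : ℝ) / ((n : ℝ) + 1)))
                ^ (((n : ℝ) + 1) / (n : ℝ)) /
            (∫ x : EuclideanSpace ℝ (Fin n),
              ‖ψ x‖ ^ (2 * (n : ℝ) / ((n : ℝ) - 1))) ^ (((n : ℝ) - 1) / (n : ℝ)) } <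
      (n : ℝ) ^ 2 / 4 * sphereVol n ^ ((2 : ℝ) / (n : ℝ)) := by
  have hn' : (2 : ℝ) ≤ n := by exact_mod_cast hn
  have hA : 0 < ‖Φ₀‖ := norm_pos_iff.2 hΦ
  have hW := sphereVol_pos n
  set i₀ : Fin n := ⟨0, by omega⟩
  obtain ⟨α, hα⟩ : ∃ α, α = Φ₀ + γ (EuclideanSpace.single i₀ 1) Φ₀ := ⟨_, rfl⟩
  obtain ⟨β, hβ⟩ : ∃ β, β = γ (EuclideanSpace.single i₀ 1) Φ₀ - Φ₀ := ⟨_, rfl⟩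
  have hφ : φt = fun x => conformalFactor x ^ ((n : ℝ) / 2) • (α + γ x β) := by
    rw [hφt]
    funext x
    rw [psiNeg, psiPos, ← smul_add, hα, hβ, map_sub]
    congr 1
    abel
  set q : ℝ := (n : ℝ) / (n + 1) with hq
  set p : ℝ := (n : ℝ) / (n - 1) with hp
  have hq0 : 0 < q := by positivity
  have hq1 : q ≤ 1 := by rw [hq, div_le_one (by positivity)]; linarith
  have hp1 : 1 < p := by rw [hp, one_lt_div (by linarith)]; linarith
  have hs := fun x : EuclideanSpace ℝ (Fin n) => abs_le.1 (abs_conformalFactor_mul_apply_le x i₀)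
  have hnφ : ∀ x, ‖φt x‖ ^ (2 * (n : ℝ) / ((n : ℝ) - 1)) =
      (2 * (2 * ‖Φ₀‖ ^ 2)) ^ p *
        (conformalFactor x ^ n * (1 - conformalFactor x * x i₀) ^ p) := fun x => by
    rw [hφ, ← Real.rpow_natCast (conformalFactor x)]
    refine norm_conformal_spinor_rpow (a := n / 2) (by positivity) (by linarith [hs x]) ?_
      (by rw [hp, mul_div_assoc]) ?_ ?_
    · rw [(norm_sq_clifford_affine hcl hsk i₀ Φ₀ x hα hβ).1]
      linear_combination 2 * ‖Φ₀‖ ^ 2 * x i₀ * conformalFactor_mul x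
    · have : (n : ℝ) - 1 ≠ 0 := by linarith
      rw [hp]; field_simp
    · rw [← Real.rpow_natCast, ← Real.rpow_mul (conformalFactor_pos x).le]
      congr 1; push_cast; ring
  have hnD : ∀ x, ‖Dirac γ φt x‖ ^ (2 * (n : ℝ) / ((n : ℝ) + 1)) =
      (2 * ((n : ℝ) ^ 2 / 2 * ‖Φ₀‖ ^ 2)) ^ q *
        (conformalFactor x ^ n * (1 + conformalFactor x * x i₀) ^ q) := fun x => by
    rw [hφ, dirac_conformal_spinor hcl, mul_comm (-((n : ℝ) / 2)), mul_smul,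
      ← Real.rpow_natCast (conformalFactor x)]
    refine norm_conformal_spinor_rpow (a := n / 2 + 1) (by positivity) (by linarith [hs x]) ?_
      (by rw [hq, mul_div_assoc]) ?_ ?_
    · rw [norm_smul, mul_pow, (norm_sq_clifford_affine hcl hsk i₀ Φ₀ x hα hβ).2,
        Real.norm_eq_abs, sq_abs]
      linear_combination - (n : ℝ) ^ 2 / 2 * ‖Φ₀‖ ^ 2 * x i₀ * conformalFactor_mul x
    · rw [hq]; field_simp; ring
    · rw [← Real.rpow_natCast, ← Real.rpow_mul (conformalFactor_pos x).le]
      congr 1; push_cast; ring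
  have hiφ : Integrable fun x => ‖φt x‖ ^ (2 * (n : ℝ) / ((n : ℝ) - 1)) := by
    simp only [hnφ]
    exact (integrable_conformalFactor_pow_mul_comp i₀ (g := fun s => (1 - s) ^ p)
      ((by fun_prop : Continuous fun s : ℝ => 1 - s).rpow_const
        fun _ => .inr (by linarith))).const_mul _
  have hiD : Integrable fun x => ‖Dirac γ φt x‖ ^ (2 * (n : ℝ) / ((n : ℝ) + 1)) := by
    simp only [hnD]
    exact (integrable_conformalFactor_pow_mul_comp i₀ (g := fun s => (1 + s) ^ q)
      ((by fun_prop : Continuous fun s : ℝ => 1 + s).rpow_const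
        fun _ => .inr hq0.le)).const_mul _
  have hP := lt_integral_conformalFactor_pow_mul_rpow i₀ hp1
  have hQ := integral_conformalFactor_pow_mul_rpow_le i₀ hq0.le hq1
  have hQ0 : 0 ≤ ∫ x : EuclideanSpace ℝ (Fin n),
      conformalFactor x ^ n * (1 + conformalFactor x * x i₀) ^ q :=
    integral_nonneg fun x => mul_nonneg (pow_pos (conformalFactor_pos x) n).le
      (Real.rpow_nonneg (by linarith [hs x]) _)
  have hIφ : 0 < (∫ x, ‖φt x‖ ^ (2 * (n : ℝ) / ((n : ℝ) - 1))) ^ (((n : ℝ) - 1) / n) := by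
    simp only [hnφ]
    rw [integral_const_mul]
    exact Real.rpow_pos_of_pos (mul_pos (by positivity) (hW.trans hP)) _
  have hlt : (∫ x, ‖Dirac γ φt x‖ ^ (2 * (n : ℝ) / ((n : ℝ) + 1))) ^ (((n : ℝ) + 1) / n) <
      (n : ℝ) ^ 2 / 4 * sphereVol n ^ ((2 : ℝ) / n) *
        (∫ x, ‖φt x‖ ^ (2 * (n : ℝ) / ((n : ℝ) - 1))) ^ (((n : ℝ) - 1) / n) := by
    have hn1 : (n : ℝ) - 1 ≠ 0 := by linarith
    simp only [hnφ, hnD]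
    rw [integral_const_mul, integral_const_mul, Real.mul_rpow (by positivity) hQ0,
      Real.mul_rpow (by positivity) (hW.trans hP).le, ← Real.rpow_mul (by positivity),
      ← Real.rpow_mul (by positivity), show q * (((n : ℝ) + 1) / n) = 1 by rw [hq]; field_simp,
      show p * (((n : ℝ) - 1) / n) = 1 by rw [hp]; field_simp, Real.rpow_one, Real.rpow_one]
    have h1 := Real.rpow_le_rpow hQ0 hQ (show 0 ≤ ((n : ℝ) + 1) / n by positivity)
    have h2 := Real.rpow_lt_rpow hW.le hP
      (show 0 < ((n : ℝ) - 1) / n from div_pos (by linarith) (by linarith))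
    rw [show ((n : ℝ) + 1) / n = 2 / n + (n - 1) / n by ring, Real.rpow_add hW] at h1
    have h3 := h1.trans_lt (mul_lt_mul_of_pos_left h2 (Real.rpow_pos_of_pos hW (2 / (n : ℝ))))
    rw [show (2 : ℝ) / n + (n - 1) / n = (n + 1) / n by ring] at h3
    have h4 := mul_lt_mul_of_pos_left h3 (show 0 < (n : ℝ) ^ 2 * ‖Φ₀‖ ^ 2 by positivity)
    linarith
  have hdiff : Differentiable ℝ φt := by
    rw [hφ]
    exact fun x => (hasFDerivAt_conformal_spinor α β x).differentiableAt
  have hne : φt ≠ 0 := by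
    intro h0
    refine hIφ.ne' ?_
    have h1 : 2 * (n : ℝ) / ((n : ℝ) - 1) ≠ 0 :=
      (div_pos (by linarith) (by linarith)).ne'
    have h2 : ((n : ℝ) - 1) / n ≠ 0 := (div_pos (by linarith) (by linarith)).ne'
    simp [h0, Real.zero_rpow h1, Real.zero_rpow h2]
  refine ⟨hiD, hiφ, hlt, lt_of_le_of_lt (csInf_le ⟨0, ?_⟩ ?_) ((div_lt_iff₀ hIφ).2 hlt)⟩
  · rintro r ⟨ψ, -, -, -, -, rfl⟩
    exact div_nonneg
      (Real.rpow_nonneg (integral_nonneg fun x => Real.rpow_nonneg (norm_nonneg _) _) _)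
      (Real.rpow_nonneg (integral_nonneg fun x => Real.rpow_nonneg (norm_nonneg _) _) _)
  · exact ⟨φt, hdiff, hne, hiD, hiφ, rfl⟩
end
end

section
/- For every n ≥ 1, the function x ↦ (1+‖x‖²)^{−n} is integrable on ℝⁿ = EuclideanSpace ℝ (Fin n) with respect to Lebesgue measure, and ∫_{ℝⁿ} (1+‖x‖²)^{−n} dx = 2^{−n} ωₙ = 2^{1−n} π^{(n+1)/2} / Γ((n+1)/2). (This is the total volume identity obtained from the stereographic projection of the round n-sphere, whose volume element is (2/(1+‖x‖²))ⁿ dx.) -/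
open MeasureTheory

noncomputable section

section JapaneseBracket

open Module Set

variable {V : Type*} [NormedAddCommGroup V] [InnerProductSpace ℝ V] [FiniteDimensional ℝ V]
  [MeasurableSpace V] [BorelSpace V]

theorem integrable_one_add_norm_sq_rpow_neg {s : ℝ} (hs : (finrank ℝ V : ℝ) / 2 < s) :
    Integrable (fun x : V => (1 + ‖x‖ ^ 2) ^ (-s)) := by
  have h := integrable_rpow_neg_one_add_norm_sq (E := V) (μ := volume) (r := 2 * s) (by linarith)
  simpa only [show -(2 * s) / 2 = -s by ring] using h

/-- The integral of `(1 + ‖x‖²) ^ (-s)` over a Euclidean space of dimension `d < 2 s`. -/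
theorem integral_one_add_norm_sq_rpow_neg_eq_Gamma {s : ℝ} (hs : (finrank ℝ V : ℝ) / 2 < s) :
    ∫ x : V, (1 + ‖x‖ ^ 2) ^ (-s) =
      Real.pi ^ ((finrank ℝ V : ℝ) / 2) * Real.Gamma (s - (finrank ℝ V : ℝ) / 2) /
        Real.Gamma s := by
  have hs0 : 0 < s := lt_of_le_of_lt (by positivity) hs
  have hΓ : 0 < Real.Gamma s := Real.Gamma_pos_of_pos hs0
  let F : V → ℝ → ℝ := fun x t => t ^ (s - 1) * Real.exp (-((1 + ‖x‖ ^ 2) * t))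
  have inner_t (x : V) :
      ∫ t in Ioi (0 : ℝ), F x t = (1 + ‖x‖ ^ 2) ^ (-s) * Real.Gamma s := by
    have hx : 0 < 1 + ‖x‖ ^ 2 := by positivity
    rw [Real.integral_rpow_mul_exp_neg_mul_Ioi hs0 hx, one_div, Real.inv_rpow hx.le,
      Real.rpow_neg hx.le]
  have inner_x (t : ℝ) (ht : t ∈ Ioi (0 : ℝ)) :
      ∫ x : V, F x t = Real.pi ^ ((finrank ℝ V : ℝ) / 2) *
        (t ^ (s - (finrank ℝ V : ℝ) / 2 - 1) * Real.exp (-(1 * t))) := by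
    have ht : 0 < t := ht
    have hF (x : V) : F x t =
        t ^ (s - 1) * Real.exp (-t) * Real.exp (-t * ‖x‖ ^ 2) := by
      rw [mul_assoc, ← Real.exp_add]
      simp only [F]
      ring_nf
    simp_rw [hF]
    rw [integral_const_mul, GaussianFourier.integral_rexp_neg_mul_sq_norm ht,
      Real.div_rpow Real.pi_pos.le ht.le, one_mul,
      show s - (finrank ℝ V : ℝ) / 2 - 1 = s - 1 - (finrank ℝ V : ℝ) / 2 by ring,
      Real.rpow_sub ht (s - 1)]
    ring
  have hint : Integrable (Function.uncurry F)
      ((volume : Measure V).prod (volume.restrict (Ioi (0 : ℝ)))) := by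
    rw [integrable_prod_iff (by
      refine Measurable.aestronglyMeasurable ?_
      simp only [F, Function.uncurry_def]
      fun_prop)]
    constructor
    · refine .of_forall fun x => .of_integral_ne_zero ?_
      simp only [Function.uncurry_apply_pair]
      rw [inner_t]
      positivity
    · refine ((integrable_one_add_norm_sq_rpow_neg hs).mul_const (Real.Gamma s)).congr
        (.of_forall fun x => ?_)
      simp only [Function.uncurry_apply_pair]
      rw [← inner_t]
      refine setIntegral_congr_fun measurableSet_Ioi fun t ht => ?_
      have ht : 0 < t := ht
      exact (Real.norm_of_nonneg (by positivity)).symm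
  rw [eq_div_iff hΓ.ne', ← integral_mul_const]
  simp_rw [← inner_t]
  rw [integral_integral_swap hint, setIntegral_congr_fun measurableSet_Ioi inner_x,
    integral_const_mul, Real.integral_rpow_mul_exp_neg_mul_Ioi (by linarith) one_pos]
  simp

end JapaneseBracket

/-- For `n ≥ 1`, the function `x ↦ (1+‖x‖²)^{−n}` is integrable on
`ℝⁿ` and `∫ (1+‖x‖²)^{−n} dx = 2^{−n} ωₙ = 2^{1−n} π^{(n+1)/2} / Γ((n+1)/2)`. -/
theorem integral_one_add_norm_sq_rpow_neg (n : ℕ) (hn : 1 ≤ n) :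
    Integrable (fun x : EuclideanSpace ℝ (Fin n) =>
      (1 + ‖x‖ ^ 2) ^ (-(n : ℝ))) ∧
    (∫ x : EuclideanSpace ℝ (Fin n), (1 + ‖x‖ ^ 2) ^ (-(n : ℝ))) =
      (2 : ℝ) ^ (-(n : ℝ)) * sphereVol n ∧
    (∫ x : EuclideanSpace ℝ (Fin n), (1 + ‖x‖ ^ 2) ^ (-(n : ℝ))) =
      (2 : ℝ) ^ ((1 : ℝ) - (n : ℝ)) * Real.pi ^ (((n : ℝ) + 1) / 2) /
        Real.Gamma (((n : ℝ) + 1) / 2) := by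
  have hn0 : (0 : ℝ) < n := by exact_mod_cast hn
  have hdim : (Module.finrank ℝ (EuclideanSpace ℝ (Fin n)) : ℝ) / 2 < n := by
    rw [finrank_euclideanSpace_fin]
    linarith
  have hval : (∫ x : EuclideanSpace ℝ (Fin n), (1 + ‖x‖ ^ 2) ^ (-(n : ℝ))) =
      (2 : ℝ) ^ ((1 : ℝ) - (n : ℝ)) * Real.pi ^ (((n : ℝ) + 1) / 2) /
        Real.Gamma (((n : ℝ) + 1) / 2) := by
    have hdup := Real.Gamma_mul_Gamma_add_half ((n : ℝ) / 2)
    rw [mul_div_cancel₀ (n : ℝ) two_ne_zero, ← add_div] at hdup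
    have hΓ : Real.Gamma n ≠ 0 := (Real.Gamma_pos_of_pos hn0).ne'
    have hΓ' : Real.Gamma (((n : ℝ) + 1) / 2) ≠ 0 := (Real.Gamma_pos_of_pos (by positivity)).ne'
    rw [integral_one_add_norm_sq_rpow_neg_eq_Gamma hdim, finrank_euclideanSpace_fin, sub_half,
      div_eq_div_iff hΓ hΓ', mul_assoc, hdup, add_div, Real.rpow_add Real.pi_pos,
      Real.sqrt_eq_rpow]
    ring
  refine ⟨integrable_one_add_norm_sq_rpow_neg hdim, ?_, hval⟩
  rw [hval, sphereVol, sub_eq_add_neg, Real.rpow_add two_pos, Real.rpow_one]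
  ring
end
end

section
/- Let E = EuclideanSpace ℝ (Fin (n+1)) with n ≥ 1, fix b ∈ E with 0 < ‖b‖ < 1, and let Ξ be the associated Möbius transformation. Then for every x ∈ E with 1+⟨x,b⟩ ≠ 0, Ξ is differentiable at x and for every v ∈ E its Fréchet derivative satisfies fderiv ℝ Ξ x (v) = ν^{−2}(1+⟨x,b⟩)^{−2} · ( ν(1+⟨x,b⟩) v − ν⟨v,b⟩ x + (1−ν)‖b‖^{−2} ⟨v,b⟩ b ). -/
open scoped RealInnerProductSpace

noncomputable section

/-- `ν = (1 − ‖b‖²)^{−1/2}`. -/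
def mobNu {E : Type*} [NormedAddCommGroup E] [InnerProductSpace ℝ E] (b : E) : ℝ :=
  (1 - ‖b‖ ^ 2) ^ (-(1 : ℝ) / 2)

/-- `μ = (ν − 1)/‖b‖²`. -/
def mobMu {E : Type*} [NormedAddCommGroup E] [InnerProductSpace ℝ E] (b : E) : ℝ :=
  (mobNu b - 1) / ‖b‖ ^ 2

/-- The Möbius transformation `Ξ(x) = (x + (μ⟨x,b⟩ + ν)b) / (ν(1+⟨x,b⟩))`. -/
def mobXi {E : Type*} [NormedAddCommGroup E] [InnerProductSpace ℝ E] (b x : E) : E :=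
  (mobNu b * (1 + ⟪x, b⟫))⁻¹ • (x + (mobMu b * ⟪x, b⟫ + mobNu b) • b)

theorem mobNu_pos {E : Type*} [NormedAddCommGroup E] [InnerProductSpace ℝ E] {b : E}
    (hb : ‖b‖ < 1) : 0 < mobNu b :=
  Real.rpow_pos_of_pos (by nlinarith [norm_nonneg b]) _

theorem mobNu_sq_mul {E : Type*} [NormedAddCommGroup E] [InnerProductSpace ℝ E] {b : E}
    (hb : ‖b‖ < 1) : mobNu b ^ 2 * (1 - ‖b‖ ^ 2) = 1 := by
  have h : 0 < 1 - ‖b‖ ^ 2 := by nlinarith [norm_nonneg b]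
  have hsq : mobNu b ^ 2 = (1 - ‖b‖ ^ 2)⁻¹ := by
    rw [mobNu, ← Real.rpow_natCast, ← Real.rpow_mul h.le, ← Real.rpow_neg_one]
    norm_num
  rw [hsq, inv_mul_cancel₀ h.ne']

/-- The quotient-rule form of the derivative of the Möbius transformation. -/
theorem hasFDerivAt_mobXi {E : Type*} [NormedAddCommGroup E] [InnerProductSpace ℝ E] {b x : E}
    (hb : ‖b‖ < 1) (hx : 1 + ⟪x, b⟫ ≠ 0) :
    HasFDerivAt (mobXi b)
      ((mobNu b * (1 + ⟪x, b⟫))⁻¹ •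
          (ContinuousLinearMap.id ℝ E + (mobMu b • innerSL ℝ b).smulRight b) +
        ((-((mobNu b * (1 + ⟪x, b⟫)) ^ 2)⁻¹) • mobNu b • innerSL ℝ b).smulRight
          (x + (mobMu b * ⟪x, b⟫ + mobNu b) • b)) x := by
  have hin : HasFDerivAt (fun y : E => ⟪y, b⟫) (innerSL ℝ b) x := by
    simp only [real_inner_comm b]
    exact (innerSL ℝ b).hasFDerivAt
  have hD : mobNu b * (1 + ⟪x, b⟫) ≠ 0 := mul_ne_zero (mobNu_pos hb).ne' hx
  have hden := (hasDerivAt_inv hD).comp_hasFDerivAt x ((hin.const_add 1).const_mul (mobNu b))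
  have hnum := (hasFDerivAt_id (𝕜 := ℝ) x).add
    (((hin.const_mul (mobMu b)).add_const (mobNu b)).smul_const b)
  exact hden.smul hnum

/-- For `0 < ‖b‖ < 1` and `x` with `1 + ⟨x,b⟩ ≠ 0`, the Möbius
transformation `Ξ` is differentiable at `x` and its Fréchet derivative is
`fderiv ℝ Ξ x (v) = ν^{−2}(1+⟨x,b⟩)^{−2}( ν(1+⟨x,b⟩) v − ν⟨v,b⟩ x
  + (1−ν)‖b‖^{−2}⟨v,b⟩ b )`. -/
theorem mobXi_fderiv (n : ℕ) (hn : 1 ≤ n)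
    (b : EuclideanSpace ℝ (Fin (n + 1))) (hb0 : 0 < ‖b‖) (hb1 : ‖b‖ < 1)
    (x : EuclideanSpace ℝ (Fin (n + 1))) (hx : 1 + ⟪x, b⟫ ≠ 0) :
    DifferentiableAt ℝ (mobXi b) x ∧
    ∀ v : EuclideanSpace ℝ (Fin (n + 1)),
      fderiv ℝ (mobXi b) x v =
        ((mobNu b) ^ 2 * (1 + ⟪x, b⟫) ^ 2)⁻¹ •
          ((mobNu b * (1 + ⟪x, b⟫)) • v - (mobNu b * ⟪v, b⟫) • x +
            ((1 - mobNu b) * (‖b‖ ^ 2)⁻¹ * ⟪v, b⟫) • b) := by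
  have h := hasFDerivAt_mobXi hb1 hx
  refine ⟨h.differentiableAt, fun v => ?_⟩
  have hν := (mobNu_pos hb1).ne'
  have hsq := mobNu_sq_mul hb1
  have hb := hb0.ne'
  rw [h.fderiv]
  simp only [add_apply, smul_apply,
    ContinuousLinearMap.smulRight_apply, ContinuousLinearMap.id_apply, innerSL_apply_apply,
    real_inner_comm v b, smul_eq_mul, mobMu]
  match_scalars
  · field_simp
  · field_simp
    linear_combination ⟪v, b⟫ * hsq
  · field_simp
end
end

section
/- Let E = EuclideanSpace ℝ (Fin (n+1)) with n ≥ 1, fix b ∈ E with 0 < ‖b‖ < 1, and let Ξ be the associated Möbius transformation. Then Ξ restricted to the unit sphere is conformal: for every x ∈ E with ‖x‖ = 1 and all tangent vectors v, w ∈ E with ⟨v,x⟩ = 0 and ⟨w,x⟩ = 0, one has ⟨ fderiv ℝ Ξ x (v), fderiv ℝ Ξ x (w) ⟩ = ((1−‖b‖²)/(1+⟨x,b⟩)²) · ⟨v,w⟩. -/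
open scoped RealInnerProductSpace

noncomputable section

/-- The algebraic identity `1 + 2(μ − ν) + (μ − ν)²‖b‖² = 0` behind conformality. -/
theorem mobMu_sub_mobNu_quadratic {E : Type*} [NormedAddCommGroup E] [InnerProductSpace ℝ E]
    {b : E} (hb0 : 0 < ‖b‖) (hb1 : ‖b‖ < 1) :
    1 + 2 * (mobMu b - mobNu b) + (mobMu b - mobNu b) ^ 2 * ‖b‖ ^ 2 = 0 := by
  have hν := mobNu_sq_mul hb1
  have hμ : mobMu b * ‖b‖ ^ 2 = mobNu b - 1 := div_mul_cancel₀ _ (by positivity)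
  have hB : ‖b‖ ^ 2 ≠ 0 := by positivity
  refine (mul_eq_zero.mp ?_).resolve_left hB
  linear_combination (mobMu b * ‖b‖ ^ 2 - 2 * mobNu b * ‖b‖ ^ 2 + mobNu b + 1) * hμ
    + (1 - ‖b‖ ^ 2) * hν

theorem fderiv_mobXi_apply {E : Type*} [NormedAddCommGroup E] [InnerProductSpace ℝ E]
    {b x : E} (hν : mobNu b ≠ 0) (hs : 1 + ⟪x, b⟫ ≠ 0) (v : E) :
    fderiv ℝ (mobXi b) x v = (mobNu b * (1 + ⟪x, b⟫))⁻¹ •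
      (v - (⟪v, b⟫ / (1 + ⟪x, b⟫)) • x
        + (⟪v, b⟫ * (mobMu b - mobNu b) / (1 + ⟪x, b⟫)) • b) := by
  have hi : HasFDerivAt (fun y : E => ⟪y, b⟫) (innerSL ℝ b) x := by
    simpa [real_inner_comm] using (innerSL ℝ b).hasFDerivAt (x := x)
  have hc := (hasDerivAt_inv (mul_ne_zero hν hs)).comp_hasFDerivAt x
    ((hi.const_add 1).const_mul (mobNu b))
  have hf := (hasFDerivAt_id x).add
    (((hi.const_mul (mobMu b)).add_const (mobNu b)).smul_const b)
  have h : HasFDerivAt (mobXi b) _ x := hc.smul hf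
  rw [h.fderiv]
  simp [real_inner_comm v b]
  match_scalars <;> field_simp <;> ring

/-- For `0 < ‖b‖ < 1`, the Möbius transformation `Ξ` is conformal on
the unit sphere: if `‖x‖ = 1` and `v, w` are tangent to the sphere at `x`, then
`⟨ fderiv ℝ Ξ x v, fderiv ℝ Ξ x w ⟩ = ((1−‖b‖²)/(1+⟨x,b⟩)²) ⟨v,w⟩`. -/
theorem mobXi_conformal_on_sphere (n : ℕ) (hn : 1 ≤ n)
    (b : EuclideanSpace ℝ (Fin (n + 1))) (hb0 : 0 < ‖b‖) (hb1 : ‖b‖ < 1)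
    (x : EuclideanSpace ℝ (Fin (n + 1))) (hx : ‖x‖ = 1)
    (v w : EuclideanSpace ℝ (Fin (n + 1)))
    (hv : ⟪v, x⟫ = 0) (hw : ⟪w, x⟫ = 0) :
    ⟪fderiv ℝ (mobXi b) x v, fderiv ℝ (mobXi b) x w⟫ =
      (1 - ‖b‖ ^ 2) / (1 + ⟪x, b⟫) ^ 2 * ⟪v, w⟫ := by
  have hν := (mobNu_pos hb1).ne'
  have hs : 1 + ⟪x, b⟫ ≠ 0 := by
    have := neg_le_of_abs_le (abs_real_inner_le_norm x b)
    rw [hx, one_mul] at this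
    linarith
  have hq := mobMu_sub_mobNu_quadratic hb0 hb1
  have hn2 := mobNu_sq_mul hb1
  rw [fderiv_mobXi_apply hν hs, fderiv_mobXi_apply hν hs]
  have hxw : ⟪x, w⟫ = 0 := by rwa [real_inner_comm]
  simp only [inner_smul_left, inner_smul_right, inner_add_left, inner_add_right, inner_sub_left,
    inner_sub_right, hv, hxw, real_inner_self_eq_norm_sq, hx, real_inner_comm x b,
    real_inner_comm w b, conj_trivial]
  have hn3 : 1 - ‖b‖ ^ 2 = (mobNu b ^ 2)⁻¹ := eq_inv_of_mul_eq_one_right hn2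
  rw [hn3]
  field_simp
  linear_combination (⟪v, b⟫ * ⟪w, b⟫) * hq
end
end

section
/- Let E be a real inner product space and let p ∈ (1,2). For every κ > 0 there exists a constant c > 0 (depending only on p and κ) such that for all x, y ∈ E with x ≠ 0, writing w = w(x, x+y), one has ‖x+y‖^p ≥ ‖x‖^p + p‖x‖^{p−2}⟨x,y⟩ + ((1−κ)/2)·( p‖x‖^{p−2}‖y‖² + p(p−2)‖w‖^{p−2}(‖x‖ − ‖x+y‖)² ) + c · min{ ‖y‖^p, ‖x‖^{p−2}‖y‖² }. -/
open scoped RealInnerProductSpace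

noncomputable section

/-- The auxiliary vector `w(x,z)` of Figalli–Zhang: `w(x,z) =
(‖z‖ / ((2−p)‖z‖ + (p−1)‖x‖))^{1/(p−2)} x` if `‖x‖ < ‖z‖`, and `w(x,z) = x`
otherwise. -/
def wFZ {E : Type*} [NormedAddCommGroup E] [InnerProductSpace ℝ E]
    (p : ℝ) (x z : E) : E :=
  if ‖x‖ < ‖z‖ then
    ((‖z‖ / ((2 - p) * ‖z‖ + (p - 1) * ‖x‖)) ^ ((1 : ℝ) / (p - 2))) • x
  else x

open Set in
theorem taylor_bound_rpow_of_le_one {p : ℝ} (hp1 : 1 < p) (hp2 : p < 2) {t : ℝ}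
    (ht0 : 0 ≤ t) (ht1 : t ≤ 1) :
    1 + p * (t ^ 2 - 1) / 2 - p * (2 - p) / 2 * (1 - t) ^ 2 ≤ t ^ p := by
  have hd : ∀ s : ℝ, HasDerivAt
      (fun s : ℝ => s ^ p - (1 + p * (s ^ 2 - 1) / 2 - p * (2 - p) / 2 * (1 - s) ^ 2))
      (p * (s ^ (p - 1) - (1 + (p - 1) * (s - 1)))) s := fun s => by
    have h1 := Real.hasDerivAt_rpow_const (x := s) (p := p) (Or.inr hp1.le)
    have h2 := ((((hasDerivAt_id s).pow 2).sub_const 1).const_mul p).div_const 2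
    have h3 := (((hasDerivAt_id s).const_sub 1).pow 2).const_mul (p * (2 - p) / 2)
    refine (h1.sub ((h2.const_add 1).sub h3)).congr_deriv ?_
    simp only [id]
    norm_num
    ring
  have hanti : AntitoneOn
      (fun s : ℝ => s ^ p - (1 + p * (s ^ 2 - 1) / 2 - p * (2 - p) / 2 * (1 - s) ^ 2))
      (Icc 0 1) := by
    refine antitoneOn_of_deriv_nonpos (convex_Icc 0 1)
      (fun s _ => (hd s).continuousAt.continuousWithinAt)
      (fun s _ => (hd s).differentiableAt.differentiableWithinAt) fun s hs => ?_
    rw [interior_Icc] at hs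
    rw [(hd s).deriv]
    have hb := rpow_one_add_le_one_add_mul_self (s := s - 1) (by linarith [hs.1])
      (p := p - 1) (by linarith) (by linarith)
    rw [add_sub_cancel] at hb
    exact mul_nonpos_of_nonneg_of_nonpos (by linarith) (by linarith)
  have h := hanti ⟨ht0, ht1⟩ (right_mem_Icc.2 zero_le_one) ht1
  norm_num at h
  linarith

theorem one_add_div_le_rpow_one_add {p : ℝ} (hp1 : 1 < p) (hp2 : p < 2) {h : ℝ} (hh : 0 ≤ h) :
    1 + (p - 1) * h / (1 + (2 - p) * h) ≤ (1 + h) ^ (p - 1) := by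
  have hD : 0 < 1 + (2 - p) * h := by nlinarith
  have hb := rpow_one_add_le_one_add_mul_self (s := h) (by linarith)
    (p := 2 - p) (by linarith) (by linarith)
  have hprod : (1 + h) ^ (p - 1) * (1 + h) ^ (2 - p) = 1 + h := by
    rw [← Real.rpow_add (by linarith)]
    ring_nf
    exact Real.rpow_one _
  have hpos : 0 < (1 + h) ^ (p - 1) := by positivity
  have heq : 1 + (p - 1) * h / (1 + (2 - p) * h) = (1 + h) / (1 + (2 - p) * h) := by
    rw [eq_div_iff hD.ne', add_mul, div_mul_cancel₀ _ hD.ne']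
    ring
  rw [heq, div_le_iff₀ hD]
  nlinarith [mul_le_mul_of_nonneg_left hb hpos.le]

open Set in
theorem taylor_bound_rpow_one_add {p : ℝ} (hp1 : 1 < p) (hp2 : p < 2) {h : ℝ} (hh : 0 ≤ h) :
    1 + p * h + p * (p - 1) / 2 * (h ^ 2 / (1 + (2 - p) * h)) ≤ (1 + h) ^ p := by
  have hD : ∀ s : ℝ, 0 ≤ s → 0 < 1 + (2 - p) * s := fun s hs => by nlinarith
  have hd : ∀ s : ℝ, 0 ≤ s → HasDerivAt
      (fun s : ℝ => (1 + s) ^ p - (1 + p * s + p * (p - 1) / 2 * (s ^ 2 / (1 + (2 - p) * s))))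
      (p * (1 + s) ^ (p - 1) - (p + p * (p - 1) / 2 *
        ((2 * s * (1 + (2 - p) * s) - s ^ 2 * (2 - p)) / (1 + (2 - p) * s) ^ 2))) s :=
    fun s hs => by
    have h1 := ((hasDerivAt_id s).const_add 1).rpow_const (p := p) (Or.inr hp1.le)
    have h2 := ((hasDerivAt_id s).const_mul p).const_add 1
    have h3 := (((hasDerivAt_id s).pow 2).div
      (((hasDerivAt_id s).const_mul (2 - p)).const_add 1) (hD s hs).ne').const_mul
        (p * (p - 1) / 2)
    refine (h1.sub (h2.add h3)).congr_deriv ?_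
    simp
  have hmono : MonotoneOn
      (fun s : ℝ => (1 + s) ^ p - (1 + p * s + p * (p - 1) / 2 * (s ^ 2 / (1 + (2 - p) * s))))
      (Ici 0) := by
    refine monotoneOn_of_deriv_nonneg (convex_Ici 0)
      (fun s hs => (hd s hs).continuousAt.continuousWithinAt)
      (fun s hs => (hd s (interior_subset hs)).differentiableAt.differentiableWithinAt)
      fun s hs => ?_
    have hs0 : 0 ≤ s := interior_subset hs
    have hDs := hD s hs0
    rw [(hd s hs0).deriv]
    have hb := mul_le_mul_of_nonneg_left (one_add_div_le_rpow_one_add hp1 hp2 hs0)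
      (by linarith : 0 ≤ p)
    have hq : (2 * s * (1 + (2 - p) * s) - s ^ 2 * (2 - p)) / (1 + (2 - p) * s) ^ 2
        ≤ 2 * (s / (1 + (2 - p) * s)) := by
      rw [← mul_div_assoc, div_le_div_iff₀ (by positivity) hDs]
      have : 0 ≤ s ^ 2 * (2 - p) * (1 + (2 - p) * s) :=
        mul_nonneg (mul_nonneg (sq_nonneg s) (by linarith)) hDs.le
      linear_combination this
    have hq' := mul_le_mul_of_nonneg_left hq
      (div_nonneg (mul_nonneg (by linarith : 0 ≤ p) (by linarith : 0 ≤ p - 1)) zero_le_two)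
    rw [mul_div_assoc] at hb
    linear_combination hb + hq'
  have h' := hmono self_mem_Ici hh hh
  norm_num at h'
  linarith

/-- The normalized form of `‖wFZ p x z‖ ^ (p - 2)`, with `t = ‖z‖ / ‖x‖`. -/
def wFZWeight (p t : ℝ) : ℝ := if 1 < t then t / ((2 - p) * t + (p - 1)) else 1

theorem wFZWeight_taylor {p : ℝ} (hp1 : 1 < p) (hp2 : p < 2) {t : ℝ} (ht : 1 < t) :
    1 + p * (t ^ 2 - 1) / 2 - p * (2 - p) / 2 * wFZWeight p t * (1 - t) ^ 2
      = 1 + p * (t - 1) + p * (p - 1) / 2 * ((t - 1) ^ 2 / ((2 - p) * t + (p - 1))) := by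
  have hD : 0 < (2 - p) * t + (p - 1) := by nlinarith
  rw [wFZWeight, if_pos ht]
  generalize hDt : (2 - p) * t + (p - 1) = D at hD ⊢
  field_simp
  rw [← hDt]
  ring

theorem wFZWeight_defect_nonneg {p : ℝ} (hp1 : 1 < p) (hp2 : p < 2) {t : ℝ} (ht : 0 ≤ t) :
    1 + p * (t ^ 2 - 1) / 2 - p * (2 - p) / 2 * wFZWeight p t * (1 - t) ^ 2 ≤ t ^ p := by
  rcases le_or_gt t 1 with h | h
  · rw [wFZWeight, if_neg h.not_gt, mul_one]
    exact taylor_bound_rpow_of_le_one hp1 hp2 ht h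
  · rw [wFZWeight_taylor hp1 hp2 h]
    have := taylor_bound_rpow_one_add hp1 hp2 (h := t - 1) (by linarith)
    rw [show 1 + (2 - p) * (t - 1) = (2 - p) * t + (p - 1) by ring, add_sub_cancel] at this
    exact this

theorem wFZWeight_linear_bound {p : ℝ} (hp1 : 1 < p) (hp2 : p < 2) {t : ℝ} (ht : 1 < t) :
    1 + p * (t ^ 2 - 1) / 2 - p * (2 - p) / 2 * wFZWeight p t * (1 - t) ^ 2
      ≤ (1 + p + p * (p - 1) / (2 * (2 - p))) * t := by
  have hD : 0 < (2 - p) * t + (p - 1) := by nlinarith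
  have h2p : 0 < 2 - p := by linarith
  rw [wFZWeight_taylor hp1 hp2 ht]
  have hq : (t - 1) ^ 2 / ((2 - p) * t + (p - 1)) ≤ t / (2 - p) := by
    rw [div_le_div_iff₀ hD h2p]
    nlinarith [mul_pos h2p (by linarith : 0 < t), mul_pos (by linarith : 0 < t) (sub_pos.2 hp1)]
  have hq' := mul_le_mul_of_nonneg_left hq
    (div_nonneg (mul_nonneg (by linarith : 0 ≤ p) (by linarith : 0 ≤ p - 1)) zero_le_two)
  have he : p * (p - 1) / 2 * (t / (2 - p)) = p * (p - 1) / (2 * (2 - p)) * t := by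
    field_simp
  rw [he] at hq'
  nlinarith

theorem div_le_one_sub_mul_wFZWeight {p : ℝ} (hp1 : 1 < p) (hp2 : p < 2) {t T : ℝ}
    (hT : 1 ≤ T) (htT : t ≤ T) :
    (p - 1) / T ≤ 1 - (2 - p) * wFZWeight p t := by
  have hT0 : 0 < T := by linarith
  rw [wFZWeight]
  split_ifs with h
  · have hD : 0 < (2 - p) * t + (p - 1) := by nlinarith
    have : 1 - (2 - p) * (t / ((2 - p) * t + (p - 1))) = (p - 1) / ((2 - p) * t + (p - 1)) := by
      field_simp
      ring
    rw [this]
    exact div_le_div_of_nonneg_left (by linarith) hD (by nlinarith)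
  · rw [div_le_iff₀ hT0]
    nlinarith

theorem wFZWeight_nonneg {p : ℝ} (hp1 : 1 < p) (hp2 : p < 2) (t : ℝ) : 0 ≤ wFZWeight p t := by
  rw [wFZWeight]
  split_ifs with h
  · have hD : 0 < (2 - p) * t + (p - 1) := by nlinarith
    exact div_nonneg (by linarith) hD.le
  · exact zero_le_one

theorem figalli_zhang_scalar (p : ℝ) (hp1 : 1 < p) (hp2 : p < 2) (κ : ℝ) (hκ : 0 < κ) :
    ∃ c : ℝ, 0 < c ∧ ∀ t r : ℝ, 0 ≤ t → 0 ≤ r → |1 - t| ≤ r → r ≤ 1 + t →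
      1 + p * ((t ^ 2 - 1 - r ^ 2) / 2) +
          (1 - κ) / 2 * (p * r ^ 2 + p * (p - 2) * wFZWeight p t * (1 - t) ^ 2) +
          c * min (r ^ p) (r ^ 2) ≤ t ^ p := by
  have hp0 : 0 < p := by linarith
  have hp1' : 0 < p - 1 := by linarith
  have h2p : 0 < 2 - p := by linarith
  set C : ℝ := 1 + p + p * (p - 1) / (2 * (2 - p)) with hC
  have hC1 : 1 ≤ C := by
    have : 0 ≤ p * (p - 1) / (2 * (2 - p)) := by positivity
    linarith
  set T : ℝ := (2 * C) ^ (1 / (p - 1)) with hTdef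
  have hT1 : 1 ≤ T := Real.one_le_rpow (by linarith) (by positivity)
  have hTp : T ^ (p - 1) = 2 * C := by
    rw [hTdef, ← Real.rpow_mul (by linarith), one_div_mul_cancel hp1'.ne', Real.rpow_one]
  have hT0 : 0 < T := by linarith
  refine ⟨min (1 / 8) (κ / 2 * p * ((p - 1) / T)), by positivity, ?_⟩
  intro t r ht hr habs hrt
  set c : ℝ := min (1 / 8) (κ / 2 * p * ((p - 1) / T)) with hc
  have hc0 : 0 ≤ c := by positivity
  have hsq : (1 - t) ^ 2 ≤ r ^ 2 := sq_le_sq' (by linarith [(abs_le.1 habs).1]) (abs_le.1 habs).2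
  have hW := wFZWeight_nonneg hp1 hp2 t
  have hkey : ∀ S : ℝ, 1 ≤ S → t ≤ S →
      (p - 1) / S * r ^ 2 ≤ r ^ 2 - (2 - p) * wFZWeight p t * (1 - t) ^ 2 := fun S hS htS => by
    have h1 := div_le_one_sub_mul_wFZWeight hp1 hp2 hS htS
    nlinarith [mul_le_mul_of_nonneg_right h1 (sq_nonneg r),
      mul_le_mul_of_nonneg_left hsq (mul_nonneg h2p.le hW)]
  have hκp : 0 < κ / 2 * p := by positivity
  suffices h : c * min (r ^ p) (r ^ 2) ≤
      (t ^ p - (1 + p * (t ^ 2 - 1) / 2 - p * (2 - p) / 2 * wFZWeight p t * (1 - t) ^ 2)) +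
        κ / 2 * p * (r ^ 2 - (2 - p) * wFZWeight p t * (1 - t) ^ 2) by
    linear_combination h
  rcases le_or_gt t T with htT | htT
  · have h1 := wFZWeight_defect_nonneg hp1 hp2 ht
    have h2 := mul_le_mul_of_nonneg_left (hkey T hT1 htT) hκp.le
    have h3 : c * min (r ^ p) (r ^ 2) ≤ κ / 2 * p * ((p - 1) / T) * r ^ 2 :=
      mul_le_mul (min_le_right _ _) (min_le_right _ _) (by positivity) (by positivity)
    linarith
  · have ht1 : 1 < t := by linarith
    have h1 := wFZWeight_linear_bound hp1 hp2 ht1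
    rw [← hC] at h1
    have h2 : 2 * C * t ≤ t ^ p := by
      have : t ^ p = t ^ (p - 1) * t := by
        rw [← Real.rpow_add_one (by linarith), sub_add_cancel]
      rw [this, ← hTp]
      gcongr
    have h3 : 0 ≤ κ / 2 * p * (r ^ 2 - (2 - p) * wFZWeight p t * (1 - t) ^ 2) :=
      mul_nonneg hκp.le (le_trans (by positivity) (hkey t ht1.le le_rfl))
    have h4 : r ^ p ≤ 4 * t ^ p := by
      calc r ^ p ≤ (2 * t) ^ p := by gcongr; linarith
        _ = 2 ^ p * t ^ p := Real.mul_rpow zero_le_two ht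
        _ ≤ 2 ^ (2 : ℝ) * t ^ p := by gcongr; norm_num
        _ = 4 * t ^ p := by norm_num
    have h5 : c * min (r ^ p) (r ^ 2) ≤ 1 / 8 * (4 * t ^ p) :=
      mul_le_mul (min_le_left _ _) ((min_le_left _ _).trans h4) (by positivity) (by norm_num)
    linarith

theorem norm_wFZ_rpow {E : Type*} [NormedAddCommGroup E] [InnerProductSpace ℝ E] {p : ℝ}
    (hp1 : 1 < p) (hp2 : p < 2) {x : E} (hx : x ≠ 0) (z : E) :
    ‖wFZ p x z‖ ^ (p - 2) = wFZWeight p (‖z‖ / ‖x‖) * ‖x‖ ^ (p - 2) := by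
  have hn : 0 < ‖x‖ := norm_pos_iff.2 hx
  have hiff : 1 < ‖z‖ / ‖x‖ ↔ ‖x‖ < ‖z‖ := one_lt_div hn
  rw [wFZ, wFZWeight]
  simp only [hiff]
  split_ifs with h
  · have hz : 0 < ‖z‖ := hn.trans h
    have hD : 0 < (2 - p) * ‖z‖ + (p - 1) * ‖x‖ :=
      add_pos (mul_pos (by linarith) hz) (mul_pos (by linarith) hn)
    have hq : 0 ≤ ‖z‖ / ((2 - p) * ‖z‖ + (p - 1) * ‖x‖) := by positivity
    rw [norm_smul, Real.norm_of_nonneg (by positivity),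
      Real.mul_rpow (by positivity) hn.le, ← Real.rpow_mul hq,
      one_div_mul_cancel (by linarith), Real.rpow_one]
    congr 1
    have : (2 - p) * (‖z‖ / ‖x‖) + (p - 1) = ((2 - p) * ‖z‖ + (p - 1) * ‖x‖) / ‖x‖ := by
      field_simp
    rw [this, div_div_div_cancel_right₀ hn.ne']
  · rw [one_mul]

/-- Figalli–Zhang pointwise inequality. For `p ∈ (1,2)` and `κ > 0`
there is `c = c(p,κ) > 0` such that for all `x ≠ 0` and `y` in a real inner product
space, with `w = w(x, x+y)`,
`‖x+y‖^p ≥ ‖x‖^p + p‖x‖^{p−2}⟨x,y⟩ + ((1−κ)/2)(p‖x‖^{p−2}‖y‖² +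
p(p−2)‖w‖^{p−2}(‖x‖−‖x+y‖)²) + c·min{‖y‖^p, ‖x‖^{p−2}‖y‖²}`. -/
theorem figalli_zhang_pointwise_ineq (p : ℝ) (hp1 : 1 < p) (hp2 : p < 2)
    (κ : ℝ) (hκ : 0 < κ) :
    ∃ c : ℝ, 0 < c ∧
      ∀ (E : Type) [NormedAddCommGroup E] [InnerProductSpace ℝ E],
        ∀ x y : E, x ≠ 0 →
          ‖x + y‖ ^ p ≥ ‖x‖ ^ p + p * ‖x‖ ^ (p - 2) * ⟪x, y⟫ +
            (1 - κ) / 2 * (p * ‖x‖ ^ (p - 2) * ‖y‖ ^ 2 +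
              p * (p - 2) * ‖wFZ p x (x + y)‖ ^ (p - 2) * (‖x‖ - ‖x + y‖) ^ 2) +
            c * min (‖y‖ ^ p) (‖x‖ ^ (p - 2) * ‖y‖ ^ 2) := by
  obtain ⟨c, hc, H⟩ := figalli_zhang_scalar p hp1 hp2 κ hκ
  refine ⟨c, hc, fun E _ _ x y hx => ?_⟩
  have hn : 0 < ‖x‖ := norm_pos_iff.2 hx
  have h := H (‖x + y‖ / ‖x‖) (‖y‖ / ‖x‖) (by positivity) (by positivity)
    (by
      rw [one_sub_div hn.ne', abs_div, abs_of_pos hn]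
      gcongr
      have := abs_norm_sub_norm_le x (x + y)
      simpa using this)
    (by
      rw [one_add_div hn.ne']
      gcongr
      have := norm_sub_le (x + y) x
      rw [add_sub_cancel_left] at this
      linarith)
  have hin : ⟪x, y⟫ = (‖x + y‖ ^ 2 - ‖x‖ ^ 2 - ‖y‖ ^ 2) / 2 := by
    rw [norm_add_sq_real]
    ring
  have hxp : ‖x‖ ^ p = ‖x‖ ^ (p - 2) * ‖x‖ ^ 2 := by
    rw [← Real.rpow_natCast, ← Real.rpow_add hn]
    norm_num
  have hsplit : ∀ s : ℝ, 0 ≤ s → s ^ p = ‖x‖ ^ p * (s / ‖x‖) ^ p := fun s hs => by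
    rw [← Real.mul_rpow hn.le (by positivity), mul_div_cancel₀ _ hn.ne']
  have hmin : min (‖y‖ ^ p) (‖x‖ ^ (p - 2) * ‖y‖ ^ 2) =
      ‖x‖ ^ p * min ((‖y‖ / ‖x‖) ^ p) ((‖y‖ / ‖x‖) ^ 2) := by
    rw [mul_min_of_nonneg _ _ (by positivity), ← hsplit _ (norm_nonneg y), hxp]
    congr 1
    field_simp
  rw [ge_iff_le, norm_wFZ_rpow hp1 hp2 hx, hmin, hin, hsplit ‖x + y‖ (norm_nonneg _)]
  refine le_trans (le_of_eq ?_) (mul_le_mul_of_nonneg_left h (by positivity : 0 ≤ ‖x‖ ^ p))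
  generalize min ((‖y‖ / ‖x‖) ^ p) ((‖y‖ / ‖x‖) ^ 2) = m
  generalize wFZWeight p (‖x + y‖ / ‖x‖) = W
  rw [hxp]
  field_simp
end
end

section
/- Let E be a real inner product space and let p ∈ (1,2). There exists a constant c > 0 (depending only on p) such that for all x, y ∈ E with x ≠ 0, writing w = w(x, x+y), one has ‖x‖^{p−2}‖y‖² + (p−2)‖w‖^{p−2}(‖x+y‖ − ‖x‖)² ≥ c · ( ‖x‖ / (‖x‖ + ‖y‖) ) · ‖x‖^{p−2}‖y‖². -/
open scoped RealInnerProductSpace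

noncomputable section

/-- The power `‖w(x,z)‖^(p-2)` in the regime `‖x‖ < ‖z‖`. -/
theorem norm_wFZ_rpow_of_lt {E : Type*} [NormedAddCommGroup E] [InnerProductSpace ℝ E]
    {p : ℝ} (hp1 : 1 < p) (hp2 : p < 2) {x z : E} (h : ‖x‖ < ‖z‖) :
    ‖wFZ p x z‖ ^ (p - 2) =
      ‖z‖ / ((2 - p) * ‖z‖ + (p - 1) * ‖x‖) * ‖x‖ ^ (p - 2) := by
  have hx := norm_nonneg x
  have hr : 0 ≤ ‖z‖ / ((2 - p) * ‖z‖ + (p - 1) * ‖x‖) :=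
    div_nonneg (norm_nonneg z) (add_nonneg (mul_nonneg (by linarith) (norm_nonneg z))
      (mul_nonneg (by linarith) hx))
  rw [wFZ, if_pos h, norm_smul, Real.norm_of_nonneg (Real.rpow_nonneg hr _),
    Real.mul_rpow (Real.rpow_nonneg hr _) hx, ← Real.rpow_mul hr,
    one_div_mul_cancel (by linarith), Real.rpow_one]

/-- For `p ∈ (1,2)` there is `c = c(p) > 0` such that for all `x ≠ 0`
and `y` in a real inner product space, with `w = w(x, x+y)`,
`‖x‖^{p−2}‖y‖² + (p−2)‖w‖^{p−2}(‖x+y‖−‖x‖)² ≥ c (‖x‖/(‖x‖+‖y‖)) ‖x‖^{p−2}‖y‖²`. -/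
theorem figalli_zhang_lower_bound (p : ℝ) (hp1 : 1 < p) (hp2 : p < 2) :
    ∃ c : ℝ, 0 < c ∧
      ∀ (E : Type) [NormedAddCommGroup E] [InnerProductSpace ℝ E],
        ∀ x y : E, x ≠ 0 →
          ‖x‖ ^ (p - 2) * ‖y‖ ^ 2 +
              (p - 2) * ‖wFZ p x (x + y)‖ ^ (p - 2) * (‖x + y‖ - ‖x‖) ^ 2 ≥
            c * (‖x‖ / (‖x‖ + ‖y‖)) * (‖x‖ ^ (p - 2) * ‖y‖ ^ 2) := by
  refine ⟨p - 1, by linarith, fun E _ _ x y hx => ?_⟩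
  have ha : 0 < ‖x‖ := norm_pos_iff.mpr hx
  have hb := norm_nonneg y
  have hz : ‖x + y‖ ≤ ‖x‖ + ‖y‖ := norm_add_le x y
  have hdiff : (‖x + y‖ - ‖x‖) ^ 2 ≤ ‖y‖ ^ 2 := by
    have h := abs_norm_sub_norm_le (x + y) x
    rw [add_sub_cancel_left] at h
    exact sq_le_sq.mpr (by rwa [abs_of_nonneg hb])
  have hA : 0 ≤ ‖x‖ ^ (p - 2) := Real.rpow_nonneg ha.le _
  obtain ⟨r, hw, hr, hbound⟩ : ∃ r : ℝ, ‖wFZ p x (x + y)‖ ^ (p - 2) = r * ‖x‖ ^ (p - 2) ∧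
      0 ≤ r ∧ (p - 1) * (‖x‖ / (‖x‖ + ‖y‖)) ≤ 1 - (2 - p) * r := by
    by_cases h : ‖x‖ < ‖x + y‖
    · have hD : 0 < (2 - p) * ‖x + y‖ + (p - 1) * ‖x‖ :=
        add_pos (mul_pos (by linarith) (ha.trans h)) (mul_pos (by linarith) ha)
      refine ⟨_, norm_wFZ_rpow_of_lt hp1 hp2 h, div_nonneg (norm_nonneg _) hD.le, ?_⟩
      have hcompl : 1 - (2 - p) * (‖x + y‖ / ((2 - p) * ‖x + y‖ + (p - 1) * ‖x‖)) =
          (p - 1) * (‖x‖ / ((2 - p) * ‖x + y‖ + (p - 1) * ‖x‖)) := by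
        field_simp
        ring
      rw [hcompl]
      refine mul_le_mul_of_nonneg_left (div_le_div_of_nonneg_left ha.le hD ?_) (by linarith)
      nlinarith
    · refine ⟨1, by rw [wFZ, if_neg h, one_mul], zero_le_one, ?_⟩
      have hle : ‖x‖ / (‖x‖ + ‖y‖) ≤ 1 := div_le_one_of_le₀ (by linarith) (by linarith)
      nlinarith
  rw [hw, ge_iff_le]
  calc (p - 1) * (‖x‖ / (‖x‖ + ‖y‖)) * (‖x‖ ^ (p - 2) * ‖y‖ ^ 2)
      ≤ (1 - (2 - p) * r) * (‖x‖ ^ (p - 2) * ‖y‖ ^ 2) :=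
        mul_le_mul_of_nonneg_right hbound (mul_nonneg hA (sq_nonneg _))
    _ = ‖x‖ ^ (p - 2) * ‖y‖ ^ 2 - (2 - p) * r * ‖x‖ ^ (p - 2) * ‖y‖ ^ 2 := by ring
    _ ≤ ‖x‖ ^ (p - 2) * ‖y‖ ^ 2 -
          (2 - p) * r * ‖x‖ ^ (p - 2) * (‖x + y‖ - ‖x‖) ^ 2 :=
        sub_le_sub_left (mul_le_mul_of_nonneg_left hdiff
          (mul_nonneg (mul_nonneg (by linarith) hr) hA)) _
    _ = ‖x‖ ^ (p - 2) * ‖y‖ ^ 2 +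
          (p - 2) * (r * ‖x‖ ^ (p - 2)) * (‖x + y‖ - ‖x‖) ^ 2 := by ring
end
end
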